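/- arXiv:1301.3993 — 3 statements merged into one kernel-verified Lean document; each statement's English description precedes it below -/
import Mathlib

section
/- Given conditions (D1) and (D2), the set Φ₁ satisfies Φ₁ = Φ₁⁺ ⊎ Φ₁⁻ (a disjoint union of positive and negative roots) if and only if Φ₂ satisfies Φ₂ = Φ₂⁺ ⊎ Φ₂⁻. -/
open Pointwise

/-- The positive linear cone of a subset `A` of a real vector space: the set of
finite linear combinations of elements of `A` with all coefficients nonnegative
and at least one coefficient strictly positive. -/
def PLC {V : Type*} [AddCommGroup V] [Module ℝ V] (A : Set V) : Set V :=
  { v | ∃ c : V →₀ ℝ, (∀ a, 0 ≤ c a) ∧ ↑c.support ⊆ A ∧ c ≠ 0 ∧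
          v = c.sum fun a t => t • a }

section PLCfacts
variable {V : Type*} [AddCommGroup V] [Module ℝ V]

theorem PLC_iff (A : Set V) (v : V) : v ∈ PLC A ↔ ∃ c : V →₀ ℝ, (∀ a, 0 ≤ c a) ∧
    (∀ a, a ∉ A → c a = 0) ∧ (∃ a, 0 < c a) ∧ Finsupp.linearCombination ℝ id c = v := by
  unfold PLC
  simp only [Set.mem_setOf_eq]
  refine exists_congr fun c => ?_
  constructor
  · rintro ⟨h1, h2, h3, h4⟩
    refine ⟨h1, ?_, ?_, ?_⟩
    · intro a ha
      by_contra h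
      exact ha (h2 (by simpa using h))
    · obtain ⟨a, ha⟩ := Finsupp.ne_iff.1 h3
      exact ⟨a, lt_of_le_of_ne (h1 a) (Ne.symm (by simpa using ha))⟩
    · rw [h4, Finsupp.linearCombination_apply]; rfl
  · rintro ⟨h1, h2, ⟨a, ha⟩, h4⟩
    refine ⟨h1, ?_, ?_, ?_⟩
    · intro a ha
      by_contra h
      exact (by simpa using ha : c a ≠ 0) (h2 a h)
    · rintro rfl
      simp at ha
    · rw [← h4, Finsupp.linearCombination_apply]; rfl

theorem PLC_add {A : Set V} {v w : V} (hv : v ∈ PLC A) (hw : w ∈ PLC A) : v + w ∈ PLC A := by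
  rw [PLC_iff] at *
  obtain ⟨c, h1, h2, ⟨a, ha⟩, h4⟩ := hv
  obtain ⟨d, k1, k2, -, k4⟩ := hw
  refine ⟨c + d, fun a => add_nonneg (h1 a) (k1 a), fun a h => by simp [h2 a h, k2 a h],
    ⟨a, add_pos_of_pos_of_nonneg ha (k1 a)⟩, by rw [map_add, h4, k4]⟩

theorem PLC_smul {A : Set V} {v : V} (hv : v ∈ PLC A) {r : ℝ} (hr : 0 < r) : r • v ∈ PLC A := by
  rw [PLC_iff] at *
  obtain ⟨c, h1, h2, ⟨a, ha⟩, h4⟩ := hv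
  exact ⟨r • c, fun a => mul_nonneg hr.le (h1 a), fun a h => by simp [h2 a h],
    ⟨a, mul_pos hr ha⟩, by rw [map_smul, h4]⟩

theorem PLC_self {A : Set V} {v : V} (hv : v ∈ A) : v ∈ PLC A := by
  classical
  rw [PLC_iff]
  refine ⟨Finsupp.single v 1, fun a => ?_, fun a h => ?_, ⟨v, by simp⟩, by simp⟩
  · rw [Finsupp.single_apply]; split_ifs <;> norm_num
  · rw [Finsupp.single_apply, if_neg]; rintro rfl; exact h hv

theorem PLC_comb {A : Set V} {v w : V} (hv : v ∈ PLC A) (hw : w ∈ PLC A) {x y : ℝ}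
    (hx : 0 ≤ x) (hy : 0 ≤ y) (h : x ≠ 0 ∨ y ≠ 0) : x • v + y • w ∈ PLC A := by
  rcases hx.eq_or_lt with rfl | hx
  · have hy : 0 < y := lt_of_le_of_ne hy (by rcases h with h | h; exact absurd rfl h; exact h.symm)
    simpa using PLC_smul hw hy
  · rcases hy.eq_or_lt with rfl | hy
    · simpa using PLC_smul hv hx
    · exact PLC_add (PLC_smul hv hx) (PLC_smul hw hy)

theorem PLC_core {A : Set V} (h0 : (0 : V) ∉ PLC A) {u w p : V} (hu : u ∈ A) (hw : w ∈ A)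
    (hext : w ∉ PLC (A \ {w})) (huw : u ≠ w) (hp : p ∈ PLC A) {a y : ℝ} (ha : 0 < a)
    (h : p + a • u = y • w) : False := by
  classical
  have hd : p + a • u ∈ PLC A := PLC_add hp (PLC_smul (PLC_self hu) ha)
  rw [PLC_iff] at hp
  obtain ⟨c, h1, h2, -, h4⟩ := hp
  set d : V →₀ ℝ := c + Finsupp.single u a with hdd
  have d0 : ∀ z, 0 ≤ d z := fun z => by
    rw [hdd, Finsupp.add_apply, Finsupp.single_apply]
    have := h1 z
    split_ifs <;> linarith
  have du : 0 < d u := by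
    rw [hdd, Finsupp.add_apply, Finsupp.single_apply, if_pos rfl]
    have := h1 u
    linarith
  have dA : ∀ z, z ∉ A → d z = 0 := fun z hz => by
    rw [hdd, Finsupp.add_apply, Finsupp.single_apply, if_neg, h2 z hz, add_zero]
    rintro rfl; exact hz hu
  have dl : Finsupp.linearCombination ℝ id d = y • w := by
    rw [hdd, map_add, h4, ← h]; simp
  have key : Finsupp.linearCombination ℝ id (d.erase w) = (y - d w) • w := by
    have := Finsupp.single_add_erase w d
    have h5 : Finsupp.linearCombination ℝ id (Finsupp.single w (d w) + d.erase w) = y • w := by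
      rw [this, dl]
    rw [map_add, Finsupp.linearCombination_single, id] at h5
    rw [sub_smul, ← h5]; abel
  by_cases hy : 0 < y - d w
  · apply hext
    have : (y - d w) • w ∈ PLC (A \ {w}) := by
      rw [PLC_iff]
      refine ⟨d.erase w, fun z => ?_, fun z hz => ?_, ⟨u, ?_⟩, key⟩
      · rw [Finsupp.erase_apply]; split_ifs; exact le_rfl; exact d0 z
      · rw [Finsupp.erase_apply]; split_ifs with hzw
        · rfl
        · exact dA z fun hA => hz ⟨hA, hzw⟩
      · rw [Finsupp.erase_apply, if_neg huw]; exact du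
    have := PLC_smul this (inv_pos.2 hy)
    rwa [smul_smul, inv_mul_cancel₀ hy.ne', one_smul] at this
  · apply h0
    rw [PLC_iff]
    refine ⟨d + Finsupp.single w (-y), fun z => ?_, fun z hz => ?_, ⟨u, ?_⟩, ?_⟩
    · rw [Finsupp.add_apply, Finsupp.single_apply]
      split_ifs with hzw
      · subst hzw; linarith
      · linarith [d0 z]
    · rw [Finsupp.add_apply, Finsupp.single_apply, if_neg, dA z hz, add_zero]
      rintro rfl; exact hz hw
    · rw [Finsupp.add_apply, Finsupp.single_apply, if_neg (Ne.symm huw)]; linarith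
    · rw [map_add, dl]; simp

theorem PLC_two {A : Set V} (h0 : (0 : V) ∉ PLC A) {u w : V} (hu : u ∈ A) (hw : w ∈ A)
    (hext : w ∉ PLC (A \ {w})) (hextu : u ∉ PLC (A \ {u})) (huw : u ≠ w) {x y : ℝ}
    (hp : x • u + y • w ∈ PLC A) : 0 ≤ x ∧ 0 ≤ y := by
  constructor
  · by_contra! hx
    exact PLC_core h0 hu hw hext huw hp (a := -x) (y := y) (by linarith) (by module)
  · by_contra! hx
    exact PLC_core h0 hw hu hextu huw.symm hp (a := -y) (y := x) (by linarith) (by module)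

end PLCfacts

section Main
variable {S V₁ V₂ : Type*} [AddCommGroup V₁] [Module ℝ V₁] [AddCommGroup V₂] [Module ℝ V₂]

theorem closure_list {V : Type*} [AddCommGroup V] [Module ℝ V] (ρ : S → Module.End ℝ V)
    (w : Module.End ℝ V) :
    w ∈ Submonoid.closure (Set.range ρ) ↔ ∃ L : List S, (L.map ρ).prod = w := by
  constructor
  · intro h
    induction h using Submonoid.closure_induction with
    | mem x hx => obtain ⟨s, rfl⟩ := hx; exact ⟨[s], by simp⟩
    | one => exact ⟨[], by simp⟩
    | mul x y _ _ hx hy =>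
      obtain ⟨L, rfl⟩ := hx
      obtain ⟨M, rfl⟩ := hy
      exact ⟨L ++ M, by simp⟩
  · rintro ⟨L, rfl⟩
    apply Submonoid.list_prod_mem
    intro x hx
    obtain ⟨s, -, rfl⟩ := List.mem_map.1 hx
    exact Submonoid.subset_closure ⟨s, rfl⟩

/-- The element of the joint monoid represented by a word. -/
def wordProd (ρ₁ : S → Module.End ℝ V₁) (ρ₂ : S → Module.End ℝ V₂) (L : List S) :
    Module.End ℝ V₁ × Module.End ℝ V₂ := (L.map fun s => (ρ₁ s, ρ₂ s)).prod

theorem wp_cons (ρ₁ : S → Module.End ℝ V₁) (ρ₂ : S → Module.End ℝ V₂) (s : S) (L : List S) :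
    wordProd ρ₁ ρ₂ (s :: L) = (ρ₁ s, ρ₂ s) * wordProd ρ₁ ρ₂ L := by
  simp [wordProd]

theorem wp_append (ρ₁ : S → Module.End ℝ V₁) (ρ₂ : S → Module.End ℝ V₂) (L M : List S) :
    wordProd ρ₁ ρ₂ (L ++ M) = wordProd ρ₁ ρ₂ L * wordProd ρ₁ ρ₂ M := by
  simp [wordProd]

theorem wp_nil (ρ₁ : S → Module.End ℝ V₁) (ρ₂ : S → Module.End ℝ V₂) :
    wordProd ρ₁ ρ₂ [] = 1 := by
  simp [wordProd]

theorem wp_fst (ρ₁ : S → Module.End ℝ V₁) (ρ₂ : S → Module.End ℝ V₂) (L : List S) :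
    (wordProd ρ₁ ρ₂ L).1 = (L.map ρ₁).prod := by
  induction L with
  | nil => simp [wp_nil]
  | cons s L ih => simp [wp_cons, ih]

theorem wp_snd (ρ₁ : S → Module.End ℝ V₁) (ρ₂ : S → Module.End ℝ V₂) (L : List S) :
    (wordProd ρ₁ ρ₂ L).2 = (L.map ρ₂).prod := by
  induction L with
  | nil => simp [wp_nil]
  | cons s L ih => simp [wp_cons, ih]

variable (pair : V₁ →ₗ[ℝ] V₂ →ₗ[ℝ] ℝ) (α : S → V₁) (β : S → V₂)
    (ρ₁ : S → Module.End ℝ V₁) (ρ₂ : S → Module.End ℝ V₂)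

theorem wp_pair (D1 : ∀ s, pair (α s) (β s) = 1)
    (hρ₁ : ∀ s x, ρ₁ s x = x - (2 * pair x (β s)) • α s)
    (hρ₂ : ∀ s y, ρ₂ s y = y - (2 * pair (α s) y) • β s) (L : List S) :
    ∀ x y, pair ((wordProd ρ₁ ρ₂ L).1 x) ((wordProd ρ₁ ρ₂ L).2 y) = pair x y := by
  induction L with
  | nil => intro x y; simp [wp_nil]
  | cons s L ih =>
    intro x y
    rw [wp_cons, ← ih x y]
    simp only [Prod.fst_mul, Prod.snd_mul, Module.End.mul_apply, hρ₁, hρ₂, map_sub, map_smul,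
      LinearMap.sub_apply, LinearMap.smul_apply, smul_eq_mul, D1]
    ring

theorem rho_sq (D1 : ∀ s, pair (α s) (β s) = 1)
    (hρ₁ : ∀ s x, ρ₁ s x = x - (2 * pair x (β s)) • α s)
    (hρ₂ : ∀ s y, ρ₂ s y = y - (2 * pair (α s) y) • β s) (s : S) :
    ((ρ₁ s, ρ₂ s) : Module.End ℝ V₁ × Module.End ℝ V₂) * (ρ₁ s, ρ₂ s) = 1 := by
  ext x
  · simp only [Prod.fst_mul, Module.End.mul_apply, hρ₁, map_sub, map_smul,
      LinearMap.sub_apply, LinearMap.smul_apply, smul_eq_mul, D1, Prod.fst_one, Module.End.one_apply]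
    module
  · simp only [Prod.snd_mul, Module.End.mul_apply, hρ₂, map_sub, map_smul,
      LinearMap.sub_apply, LinearMap.smul_apply, smul_eq_mul, D1, Prod.snd_one, Module.End.one_apply]
    module

theorem wp_comm (D1 : ∀ s, pair (α s) (β s) = 1)
    (hρ₁ : ∀ s x, ρ₁ s x = x - (2 * pair x (β s)) • α s)
    (hρ₂ : ∀ s y, ρ₂ s y = y - (2 * pair (α s) y) • β s) (L : List S) (s r : S) (c d : ℝ)
    (hc : (wordProd ρ₁ ρ₂ L).1 (α s) = c • α r) (hd : (wordProd ρ₁ ρ₂ L).2 (β s) = d • β r) :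
    wordProd ρ₁ ρ₂ (r :: L) * (ρ₁ s, ρ₂ s) = wordProd ρ₁ ρ₂ L := by
  have hp := wp_pair pair α β ρ₁ ρ₂ D1 hρ₁ hρ₂ L
  have hcd : c * d = 1 := by
    have := hp (α s) (β s)
    rw [hc, hd] at this
    simp only [map_smul, LinearMap.smul_apply, smul_eq_mul, D1] at this
    linarith
  have key : (ρ₁ r, ρ₂ r) * wordProd ρ₁ ρ₂ L = wordProd ρ₁ ρ₂ L * (ρ₁ s, ρ₂ s) := by
    ext x
    · simp only [Prod.fst_mul, Module.End.mul_apply, hρ₁, map_sub, map_smul, hc]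
      have := hp x (β s)
      rw [hd, map_smul, smul_eq_mul] at this
      rw [← this, smul_smul]
      congr 2
      linear_combination (-2 * pair ((wordProd ρ₁ ρ₂ L).1 x) (β r)) * hcd
    · simp only [Prod.snd_mul, Module.End.mul_apply, hρ₂, map_sub, map_smul, hd]
      have := hp (α s) x
      rw [hc, map_smul, LinearMap.smul_apply, smul_eq_mul] at this
      rw [← this, smul_smul]
      congr 2
      linear_combination (-2 * pair (α r) ((wordProd ρ₁ ρ₂ L).2 x)) * hcd
  rw [wp_cons, key, mul_assoc, rho_sq pair α β ρ₁ ρ₂ D1 hρ₁ hρ₂, mul_one]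

/-- Coordinates of the dihedral action. -/
theorem dihedral_coords (D1 : ∀ s, pair (α s) (β s) = 1)
    (hρ₁ : ∀ s x, ρ₁ s x = x - (2 * pair x (β s)) • α s)
    (hρ₂ : ∀ s y, ρ₂ s y = y - (2 * pair (α s) y) • β s) (s t : S) (k : ℝ)
    (hk : pair (α s) (β t) = k * pair (α t) (β s)) (B : List S) (hB : ∀ r ∈ B, r = s ∨ r = t) :
    ∃ x y : ℝ, (wordProd ρ₁ ρ₂ B).1 (α s) = x • α s + (k * y) • α t ∧
      (wordProd ρ₁ ρ₂ B).2 (β s) = x • β s + y • β t := by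
  induction B with
  | nil => exact ⟨1, 0, by simp [wp_nil], by simp [wp_nil]⟩
  | cons r B ih =>
    obtain ⟨x, y, h1, h2⟩ := ih fun r hr => hB r (List.mem_cons_of_mem _ hr)
    rcases hB r List.mem_cons_self with rfl | rfl
    · refine ⟨-x - 2 * y * pair (α r) (β t), y, ?_, ?_⟩
      · simp only [wp_cons, Prod.fst_mul, Module.End.mul_apply, h1, hρ₁, map_add, map_smul, D1,
          LinearMap.add_apply, LinearMap.smul_apply, smul_eq_mul, hk]
        module
      · simp only [wp_cons, Prod.snd_mul, Module.End.mul_apply, h2, hρ₂, map_add, map_smul, D1,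
          LinearMap.add_apply, LinearMap.smul_apply, smul_eq_mul]
        module
    · refine ⟨x, -y - 2 * x * pair (α r) (β s), ?_, ?_⟩
      · simp only [wp_cons, Prod.fst_mul, Module.End.mul_apply, h1, hρ₁, map_add, map_smul, D1,
          LinearMap.add_apply, LinearMap.smul_apply, smul_eq_mul, hk]
        module
      · simp only [wp_cons, Prod.snd_mul, Module.End.mul_apply, h2, hρ₂, map_add, map_smul, D1,
          LinearMap.add_apply, LinearMap.smul_apply, smul_eq_mul]
        module

/-- The sign property of rank two combinations which are roots. -/
theorem root_sign (hα : Function.Injective α)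
    (D2a : (0 : V₁) ∉ PLC (Set.range α)) (D2c : ∀ s, α s ∉ PLC (Set.range α \ {α s}))
    (hpos : ∀ (L : List S) (s : S), (wordProd ρ₁ ρ₂ L).1 (α s) ∈ PLC (Set.range α) ∨
      -(wordProd ρ₁ ρ₂ L).1 (α s) ∈ PLC (Set.range α))
    {s t : S} (hst : s ≠ t) (L : List S) (r : S) {x y : ℝ}
    (h : (wordProd ρ₁ ρ₂ L).1 (α r) = x • α s + y • α t) :
    ((0 ≤ x ∧ 0 ≤ y) ∨ (x ≤ 0 ∧ y ≤ 0)) ∧ (x ≠ 0 ∨ y ≠ 0) := by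
  have two := fun x y => PLC_two (x := x) (y := y) D2a (Set.mem_range_self s)
    (Set.mem_range_self t) (D2c t) (D2c s) (hα.ne hst)
  have hh := hpos L r
  rw [h] at hh
  constructor
  · rcases hh with hh | hh
    · exact Or.inl (two _ _ hh)
    · right
      have e : -(x • α s + y • α t) = (-x) • α s + (-y) • α t := by module
      rw [e] at hh
      have := two _ _ hh
      constructor <;> linarith [this.1, this.2]
  · by_contra! hc
    obtain ⟨rfl, rfl⟩ := hc
    apply D2a
    rcases hh with hh | hh <;> simpa using hh

theorem exists_k (hα : Function.Injective α) (D1 : ∀ s, pair (α s) (β s) = 1)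
    (D2a : (0 : V₁) ∉ PLC (Set.range α)) (D2c : ∀ s, α s ∉ PLC (Set.range α \ {α s}))
    (hρ₁ : ∀ s x, ρ₁ s x = x - (2 * pair x (β s)) • α s)
    (hpos : ∀ (L : List S) (s : S), (wordProd ρ₁ ρ₂ L).1 (α s) ∈ PLC (Set.range α) ∨
      -(wordProd ρ₁ ρ₂ L).1 (α s) ∈ PLC (Set.range α))
    {s t : S} (hst : s ≠ t) : ∃ k : ℝ, 0 < k ∧ pair (α s) (β t) = k * pair (α t) (β s) := by
  have sgn : ∀ {s t : S}, s ≠ t → pair (α s) (β t) ≤ 0 := by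
    intro s t hst
    have := (root_sign α ρ₁ ρ₂ hα D2a D2c hpos hst [t] s (x := 1) (y := -2 * pair (α s) (β t))
      (by simp only [wp_cons, wp_nil, mul_one, hρ₁]; module)).1
    rcases this with h | h
    · linarith [h.2]
    · linarith [h.1]
  have zer : ∀ {s t : S}, s ≠ t → pair (α s) (β t) = 0 → pair (α t) (β s) = 0 := by
    intro s t hst h0
    have := (root_sign α ρ₁ ρ₂ hα D2a D2c hpos hst [t, s] t (x := -2 * pair (α t) (β s)) (y := -1)
      (by
        simp only [wp_cons, wp_nil, mul_one, hρ₁, Prod.fst_mul, Module.End.mul_apply, map_sub,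
          map_smul, LinearMap.sub_apply, LinearMap.smul_apply, D1, h0, smul_eq_mul]
        module)).1
    have h2 := sgn hst.symm
    rcases this with h | h
    · linarith [h.2]
    · linarith [h.1]
  by_cases h0 : pair (α t) (β s) = 0
  · exact ⟨1, one_pos, by rw [h0, zer hst.symm h0, mul_zero]⟩
  · have h1 : pair (α s) (β t) ≠ 0 := fun h => h0 (zer hst h)
    exact ⟨pair (α s) (β t) / pair (α t) (β s), div_pos_of_neg_of_neg
      (lt_of_le_of_ne (sgn hst) h1) (lt_of_le_of_ne (sgn hst.symm) h0), by field_simp⟩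

theorem dihedral_exchange (hα : Function.Injective α) (D1 : ∀ s, pair (α s) (β s) = 1)
    (D2a : (0 : V₁) ∉ PLC (Set.range α)) (D2c : ∀ s, α s ∉ PLC (Set.range α \ {α s}))
    (hρ₁ : ∀ s x, ρ₁ s x = x - (2 * pair x (β s)) • α s)
    (hρ₂ : ∀ s y, ρ₂ s y = y - (2 * pair (α s) y) • β s)
    (hpos : ∀ (L : List S) (s : S), (wordProd ρ₁ ρ₂ L).1 (α s) ∈ PLC (Set.range α) ∨
      -(wordProd ρ₁ ρ₂ L).1 (α s) ∈ PLC (Set.range α))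
    {s t : S} (hst : s ≠ t) (B : List S) (hB : ∀ r ∈ B, r = s ∨ r = t) :
    (∃ x y : ℝ, 0 ≤ x ∧ 0 ≤ y ∧ (x ≠ 0 ∨ y ≠ 0) ∧
      (wordProd ρ₁ ρ₂ B).2 (β s) = x • β s + y • β t) ∨
    (∃ B' : List S, (∀ r ∈ B', r = s ∨ r = t) ∧ B'.length < B.length ∧
      wordProd ρ₁ ρ₂ B' = wordProd ρ₁ ρ₂ B * (ρ₁ s, ρ₂ s)) := by
  obtain ⟨k, hk, hpk⟩ := exists_k pair α β ρ₁ ρ₂ hα D1 D2a D2c hρ₁ hpos hst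
  suffices H : ∀ B : List S, (∀ r ∈ B, r = s ∨ r = t) → ∀ x y : ℝ,
      (wordProd ρ₁ ρ₂ B).1 (α s) = x • α s + (k * y) • α t → x ≤ 0 → k * y ≤ 0 →
      (∃ B' : List S, (∀ r ∈ B', r = s ∨ r = t) ∧ B'.length < B.length ∧
      wordProd ρ₁ ρ₂ B' = wordProd ρ₁ ρ₂ B * (ρ₁ s, ρ₂ s)) by
    obtain ⟨x, y, h1, h2⟩ := dihedral_coords pair α β ρ₁ ρ₂ D1 hρ₁ hρ₂ s t k hpk B hB
    obtain ⟨h3 | h3, h4⟩ := root_sign α ρ₁ ρ₂ hα D2a D2c hpos hst B s h1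
    · exact Or.inl ⟨x, y, h3.1, nonneg_of_mul_nonneg_right h3.2 hk,
        h4.imp id (fun h => right_ne_zero_of_mul h), h2⟩
    · exact Or.inr (H B hB x y h1 h3.1 h3.2)
  have two := fun x y => PLC_two (x := x) (y := y) D2a (Set.mem_range_self s)
    (Set.mem_range_self t) (D2c t) (D2c s) (hα.ne hst)
  have signs : ∀ x y x' y' : ℝ, x • α s + y • α t = x' • α s + y' • α t → x ≤ 0 → y ≤ 0 →
      0 ≤ x' → 0 ≤ y' → x' = 0 ∧ y' = 0 := by
    intro x y x' y' h hx hy hx' hy'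
    by_contra hc
    apply D2a
    have := PLC_comb (PLC_self (Set.mem_range_self (f := α) s)) (PLC_self (Set.mem_range_self (f := α) t))
      (x := x' - x) (y := y' - y) (by linarith) (by linarith) (by
        by_contra! hh
        exact hc ⟨by linarith, by linarith⟩)
    have e : (x' - x) • α s + (y' - y) • α t = 0 := by
      rw [sub_smul, sub_smul, ← sub_eq_zero.2 h.symm]; abel
    rwa [e] at this
  have no_prop : ∀ {s t : S} (a y : ℝ), s ≠ t → 0 < a → a • α s = y • α t → False := by
    intro s t a y hst ha h
    refine PLC_core D2a (Set.mem_range_self s) (Set.mem_range_self t) (D2c t) (hα.ne hst)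
      (p := (a / 2) • α s) (PLC_smul (PLC_self (Set.mem_range_self s)) (half_pos ha))
      (half_pos ha) (y := y) ?_
    rw [← h]; module
  intro B
  induction B with
  | nil =>
    intro _ x y h hx hy
    exfalso
    have := signs x (k * y) 1 0 (by rw [← h]; simp [wp_nil]) hx hy (by simp) le_rfl
    simp at this
  | cons r B ih =>
    intro hB x y h hx hy
    have hB' : ∀ r ∈ B, r = s ∨ r = t := fun r hr => hB r (List.mem_cons_of_mem _ hr)
    obtain ⟨a, b, h1, h2⟩ := dihedral_coords pair α β ρ₁ ρ₂ D1 hρ₁ hρ₂ s t k hpk B hB'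
    obtain ⟨h3 | h3, h4⟩ := root_sign α ρ₁ ρ₂ hα D2a D2c hpos hst B s h1
    swap
    · obtain ⟨B', hb1, hb2, hb3⟩ := ih hB' a b h1 h3.1 h3.2
      refine ⟨r :: B', ?_, by simpa using hb2, by rw [wp_cons, wp_cons, hb3, mul_assoc]⟩
      intro q hq
      rcases List.mem_cons.1 hq with rfl | hq
      · exact hB _ List.mem_cons_self
      · exact hb1 q hq
    refine ⟨B, hB', by simp, ?_⟩
    rw [wp_cons, Prod.fst_mul, Module.End.mul_apply, h1, hρ₁] at h
    symm
    set z := pair (a • α s + (k * b) • α t) (β r) with hz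
    rcases hB r List.mem_cons_self with rfl | rfl
    · by_cases hb : b = 0
      · subst hb
        exact wp_comm pair α β ρ₁ ρ₂ D1 hρ₁ hρ₂ B r r a a (by simpa using h1) (by simpa using h2)
      · exfalso
        have hkb : 0 < k * b := lt_of_le_of_ne h3.2 (mul_ne_zero hk.ne' hb).symm
        have e : (k * b - k * y) • α t = (x - (a - 2 * z)) • α r := by
          rw [← sub_eq_zero, ← sub_eq_zero.2 h]; module
        refine no_prop _ _ hst.symm (by linarith) e
    · by_cases ha : a = 0
      · subst ha
        exact wp_comm pair α β ρ₁ ρ₂ D1 hρ₁ hρ₂ B s r (k * b) b (by simpa using h1)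
          (by simpa using h2)
      · exfalso
        have ha' : 0 < a := lt_of_le_of_ne h3.1 (Ne.symm ha)
        have e : (a - x) • α s = (k * y - (k * b - 2 * z)) • α r := by
          rw [← sub_eq_zero, ← sub_eq_zero.2 h]; module
        refine no_prop _ _ hst (by linarith) e

theorem main_pos (hα : Function.Injective α) (D1 : ∀ s, pair (α s) (β s) = 1)
    (D2a : (0 : V₁) ∉ PLC (Set.range α)) (D2c : ∀ s, α s ∉ PLC (Set.range α \ {α s}))
    (hρ₁ : ∀ s x, ρ₁ s x = x - (2 * pair x (β s)) • α s)
    (hρ₂ : ∀ s y, ρ₂ s y = y - (2 * pair (α s) y) • β s)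
    (hpos : ∀ (L : List S) (s : S), (wordProd ρ₁ ρ₂ L).1 (α s) ∈ PLC (Set.range α) ∨
      -(wordProd ρ₁ ρ₂ L).1 (α s) ∈ PLC (Set.range α)) (n : ℕ) :
    ∀ (L : List S), L.length = n →
      (∀ L', wordProd ρ₁ ρ₂ L' = wordProd ρ₁ ρ₂ L → n ≤ L'.length) → ∀ s,
      (∀ L', wordProd ρ₁ ρ₂ L' = wordProd ρ₁ ρ₂ L * (ρ₁ s, ρ₂ s) → n ≤ L'.length) →
      (wordProd ρ₁ ρ₂ L).2 (β s) ∈ PLC (Set.range β) := by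
  classical
  have sq := rho_sq pair α β ρ₁ ρ₂ D1 hρ₁ hρ₂
  induction n using Nat.strong_induction_on with
  | _ n ih =>
  intro L hL hred s hs
  rcases List.eq_nil_or_concat L with rfl | ⟨L₀, t, rfl⟩
  · simpa [wp_nil] using PLC_self (Set.mem_range_self s)
  have hlen : L₀.length + 1 = n := by simpa using hL
  have wpt : wordProd ρ₁ ρ₂ [t] = (ρ₁ t, ρ₂ t) := by rw [wp_cons, wp_nil, mul_one]
  simp only [List.concat_eq_append] at *
  have hst : s ≠ t := by
    rintro rfl
    have := hs L₀ (by rw [wp_append, wpt, mul_assoc, sq, mul_one])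
    omega
  set g := wordProd ρ₁ ρ₂ (L₀ ++ [t]) with hg
  have hex : ∃ m, ∃ A B : List S, A.length = m ∧ (∀ r ∈ B, r = s ∨ r = t) ∧
      A.length + B.length = n ∧ wordProd ρ₁ ρ₂ A * wordProd ρ₁ ρ₂ B = g :=
    ⟨L₀.length, L₀, [t], rfl, by simp, by simpa using hlen, by rw [hg, wp_append]⟩
  have hmin := fun m hm => Nat.find_min (H := hex) (m := m) hm
  have hle : Nat.find hex ≤ L₀.length := Nat.find_min' hex
    ⟨L₀, [t], rfl, by simp, by simpa using hlen, by rw [hg, wp_append]⟩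
  obtain ⟨A, B, hA, hB, hAB, hprod⟩ := Nat.find_spec hex
  rw [← hA] at hmin hle
  have hAred : ∀ L', wordProd ρ₁ ρ₂ L' = wordProd ρ₁ ρ₂ A → A.length ≤ L'.length := by
    intro L' h
    have := hred (L' ++ B) (by rw [wp_append, h, hprod])
    rw [List.length_append] at this
    omega
  have hAr : ∀ r, r = s ∨ r = t → (wordProd ρ₁ ρ₂ A).2 (β r) ∈ PLC (Set.range β) := by
    intro r hr
    refine ih A.length (by omega) A rfl hAred r ?_
    intro L' h
    by_contra! hlt
    have e : wordProd ρ₁ ρ₂ L' * wordProd ρ₁ ρ₂ (r :: B) = g := by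
      rw [h, wp_cons, mul_assoc, ← mul_assoc (ρ₁ r, ρ₂ r), sq, one_mul, hprod]
    have h2 := hred (L' ++ r :: B) (by rw [wp_append, e])
    simp only [List.length_append, List.length_cons] at h2
    refine hmin _ hlt ⟨L', r :: B, rfl, ?_, by simp only [List.length_cons]; omega, e⟩
    intro q hq
    rcases List.mem_cons.1 hq with rfl | hq
    · exact hr
    · exact hB q hq
  rcases dihedral_exchange pair α β ρ₁ ρ₂ hα D1 D2a D2c hρ₁ hρ₂ hpos hst B hB with
    ⟨x, y, hx, hy, hxy, h⟩ | ⟨B', -, h2, h3⟩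
  · rw [← hprod, Prod.snd_mul, Module.End.mul_apply, h, map_add, map_smul, map_smul]
    exact PLC_comb (hAr s (Or.inl rfl)) (hAr t (Or.inr rfl)) hx hy hxy
  · exfalso
    have := hs (A ++ B') (by rw [wp_append, h3, ← mul_assoc, hprod])
    rw [List.length_append] at this
    omega

theorem main_dir (hα : Function.Injective α) (D1 : ∀ s, pair (α s) (β s) = 1)
    (D2a : (0 : V₁) ∉ PLC (Set.range α)) (D2b : (0 : V₂) ∉ PLC (Set.range β))
    (D2c : ∀ s, α s ∉ PLC (Set.range α \ {α s}))
    (hρ₁ : ∀ s x, ρ₁ s x = x - (2 * pair x (β s)) • α s)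
    (hρ₂ : ∀ s y, ρ₂ s y = y - (2 * pair (α s) y) • β s)
    (Φ₁ : Set V₁) (Φ₂ : Set V₂)
    (hΦ₁ : Φ₁ = { v | ∃ w ∈ Submonoid.closure (Set.range ρ₁), ∃ s, v = w (α s) })
    (hΦ₂ : Φ₂ = { v | ∃ w ∈ Submonoid.closure (Set.range ρ₂), ∃ s, v = w (β s) })
    (h : Φ₁ = (Φ₁ ∩ PLC (Set.range α)) ∪ (-(Φ₁ ∩ PLC (Set.range α)))) :
    (Φ₂ = (Φ₂ ∩ PLC (Set.range β)) ∪ (-(Φ₂ ∩ PLC (Set.range β))) ∧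
        Disjoint (Φ₂ ∩ PLC (Set.range β)) (-(Φ₂ ∩ PLC (Set.range β)))) := by
  classical
  have sq := rho_sq pair α β ρ₁ ρ₂ D1 hρ₁ hρ₂
  have hpos : ∀ (L : List S) (s : S), (wordProd ρ₁ ρ₂ L).1 (α s) ∈ PLC (Set.range α) ∨
      -(wordProd ρ₁ ρ₂ L).1 (α s) ∈ PLC (Set.range α) := by
    intro L s
    have hm : (wordProd ρ₁ ρ₂ L).1 (α s) ∈ Φ₁ := by
      rw [hΦ₁]
      exact ⟨_, (closure_list ρ₁ _).2 ⟨L, (wp_fst ρ₁ ρ₂ L).symm⟩, s, rfl⟩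
    rw [h] at hm
    exact hm.imp (fun h => h.2) (fun h => h.2)
  have hneg : ∀ v ∈ Φ₂, -v ∈ Φ₂ := by
    intro v hv
    rw [hΦ₂] at hv ⊢
    obtain ⟨w, hw, s, rfl⟩ := hv
    refine ⟨w * ρ₂ s, mul_mem hw (Submonoid.subset_closure ⟨s, rfl⟩), s, ?_⟩
    rw [Module.End.mul_apply, hρ₂, D1, ← map_neg]
    congr 1
    module
  have hβpos : ∀ (L : List S) (s : S), (wordProd ρ₁ ρ₂ L).2 (β s) ∈ PLC (Set.range β) ∨
      -(wordProd ρ₁ ρ₂ L).2 (β s) ∈ PLC (Set.range β) := by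
    intro L s
    have red : ∀ g, (∃ L, wordProd ρ₁ ρ₂ L = g) → ∃ L, wordProd ρ₁ ρ₂ L = g ∧
        ∀ L', wordProd ρ₁ ρ₂ L' = g → L.length ≤ L'.length := by
      intro g hg
      have hex : ∃ n, ∃ L, wordProd ρ₁ ρ₂ L = g ∧ L.length = n := by
        obtain ⟨L, hL⟩ := hg; exact ⟨_, L, hL, rfl⟩
      obtain ⟨L, h1, h2⟩ := Nat.find_spec hex
      exact ⟨L, h1, fun L' h' => by rw [h2]; exact Nat.find_min' hex ⟨L', h', rfl⟩⟩
    have wps : wordProd ρ₁ ρ₂ [s] = (ρ₁ s, ρ₂ s) := by rw [wp_cons, wp_nil, mul_one]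
    obtain ⟨M, hM, hMr⟩ := red _ ⟨L, rfl⟩
    obtain ⟨N, hN, hNr⟩ := red (wordProd ρ₁ ρ₂ L * (ρ₁ s, ρ₂ s))
      ⟨L ++ [s], by rw [wp_append, wps]⟩
    have mp := main_pos pair α β ρ₁ ρ₂ hα D1 D2a D2c hρ₁ hρ₂ hpos
    rcases le_total M.length N.length with hle | hle
    · left
      rw [← hM]
      refine mp _ M rfl (fun L' h' => hMr L' (h'.trans hM)) s fun L' h' => ?_
      exact hle.trans (hNr L' (by rw [h', hM]))
    · right
      have := mp _ N rfl (fun L' h' => hNr L' (h'.trans hN)) s fun L' h' =>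
        hle.trans (hMr L' (by rw [h', hN, mul_assoc, sq, mul_one]))
      rw [hN, Prod.snd_mul, Module.End.mul_apply, hρ₂, D1] at this
      rw [← map_neg]
      convert this using 2
      module
  constructor
  · apply Set.Subset.antisymm
    · intro v hv
      have hv' := hv
      rw [hΦ₂] at hv'
      obtain ⟨w, hw, s, rfl⟩ := hv'
      obtain ⟨L, rfl⟩ := (closure_list ρ₂ _).1 hw
      have := hβpos L s
      rw [wp_snd] at this
      exact this.imp (fun h => ⟨hv, h⟩) (fun h => ⟨hneg _ hv, h⟩)
    · rintro v (hv | hv)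
      · exact hv.1
      · have := hneg _ hv.1
        rwa [neg_neg] at this
  · rw [Set.disjoint_left]
    rintro v hv hv'
    apply D2b
    have := PLC_add hv.2 hv'.2
    rwa [add_neg_cancel] at this

end Main

/-- Under (D1) and (D2), `Φ₁ = Φ₁⁺ ⊎ Φ₁⁻` if and only if `Φ₂ = Φ₂⁺ ⊎ Φ₂⁻`.
Here the group `Wᵢ` generated by the involutions `ρᵢ s` is realized as the closure of
`{ρᵢ s : s ∈ S}` in the multiplicative monoid of linear endomorphisms (by (D1) each
`ρᵢ s` is an involution, so this closure coincides with the generated group),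
`Φᵢ = Wᵢ Πᵢ`, `Φᵢ⁺ = Φᵢ ∩ PLC Πᵢ`, and `Φᵢ⁻ = -Φᵢ⁺`. -/
theorem stmt0 {S V₁ V₂ : Type*} [AddCommGroup V₁] [Module ℝ V₁]
    [AddCommGroup V₂] [Module ℝ V₂]
    (pair : V₁ →ₗ[ℝ] V₂ →ₗ[ℝ] ℝ) (α : S → V₁) (β : S → V₂)
    (hα : Function.Injective α) (hβ : Function.Injective β)
    (D1 : ∀ s, pair (α s) (β s) = 1)
    (D2a : (0 : V₁) ∉ PLC (Set.range α)) (D2b : (0 : V₂) ∉ PLC (Set.range β))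
    (D2c : ∀ s, α s ∉ PLC (Set.range α \ {α s}))
    (D2d : ∀ s, β s ∉ PLC (Set.range β \ {β s}))
    (ρ₁ : S → Module.End ℝ V₁) (ρ₂ : S → Module.End ℝ V₂)
    (hρ₁ : ∀ s x, ρ₁ s x = x - (2 * pair x (β s)) • α s)
    (hρ₂ : ∀ s y, ρ₂ s y = y - (2 * pair (α s) y) • β s)
    (Φ₁ : Set V₁) (Φ₂ : Set V₂)
    (hΦ₁ : Φ₁ = { v | ∃ w ∈ Submonoid.closure (Set.range ρ₁), ∃ s, v = w (α s) })
    (hΦ₂ : Φ₂ = { v | ∃ w ∈ Submonoid.closure (Set.range ρ₂), ∃ s, v = w (β s) }) :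
    (Φ₁ = (Φ₁ ∩ PLC (Set.range α)) ∪ (-(Φ₁ ∩ PLC (Set.range α))) ∧
        Disjoint (Φ₁ ∩ PLC (Set.range α)) (-(Φ₁ ∩ PLC (Set.range α)))) ↔
      (Φ₂ = (Φ₂ ∩ PLC (Set.range β)) ∪ (-(Φ₂ ∩ PLC (Set.range β))) ∧
        Disjoint (Φ₂ ∩ PLC (Set.range β)) (-(Φ₂ ∩ PLC (Set.range β)))) := by
  constructor
  · rintro ⟨h, -⟩
    exact main_dir pair α β ρ₁ ρ₂ hα D1 D2a D2b D2c hρ₁ hρ₂ Φ₁ Φ₂ hΦ₁ hΦ₂ h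
  · rintro ⟨h, -⟩
    exact main_dir pair.flip β α ρ₂ ρ₁ hβ D1 D2b D2a D2d hρ₂ hρ₁ Φ₂ Φ₁ hΦ₂ hΦ₁ h
end

section
/- Suppose that Φ₁ = Φ₁⁺ ⊎ Φ₁⁻ (a disjoint union). Define a Coxeter matrix M on S by M(s,s) = 1, M(s,t) = m_{st} if ⟨α_s, β_t⟩⟨α_t, β_s⟩ = cos²(π/m_{st}) for an integer m_{st} ≥ 2, and M(s,t) = ∞ otherwise, and let (W, {r_s : s ∈ S}) be the Coxeter system of M (so W is the abstract group generated by the involutions r_s subject only to the relations (r_s r_t)^{M(s,t)} = 1). Then there exist group isomorphisms f₁ : W → W₁ and f₂ : W → W₂ such that f₁(r_s) = ρ₁(s) and f₂(r_s) = ρ₂(s) for all s ∈ S. -/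
open Pointwise

namespace Stmt8Aux

open CoxeterSystem

section cone
variable {V : Type*} [AddCommGroup V] [Module ℝ V]

lemma plc_add {A : Set V} {x y : V} (hx : x ∈ PLC A) (hy : y ∈ PLC A) : x + y ∈ PLC A := by
  classical
  obtain ⟨c, c0, cA, cn, rfl⟩ := hx
  obtain ⟨d, d0, dA, dn, rfl⟩ := hy
  refine ⟨c + d, fun a => add_nonneg (c0 a) (d0 a), ?_, ?_, ?_⟩
  · intro a ha
    rcases Finset.mem_union.1 (Finsupp.support_add ha) with h | h
    · exact cA h
    · exact dA h
  · intro h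
    apply cn
    ext a
    have h1 : c a + d a = 0 := by simpa using DFunLike.congr_fun h a
    have := c0 a
    have := d0 a
    simp only [Finsupp.coe_zero, Pi.zero_apply]
    linarith
  · rw [Finsupp.sum_add_index']
    · simp
    · intros; rw [add_smul]

lemma plc_smul {A : Set V} {x : V} {r : ℝ} (hr : 0 < r) (hx : x ∈ PLC A) : r • x ∈ PLC A := by
  obtain ⟨c, c0, cA, cn, rfl⟩ := hx
  refine ⟨r • c, fun a => mul_nonneg hr.le (c0 a), ?_, ?_, ?_⟩
  · intro a ha
    exact cA (Finsupp.support_smul ha)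
  · intro h
    rcases smul_eq_zero.1 h with h | h
    · exact hr.ne' h
    · exact cn h
  · rw [Finsupp.sum_smul_index (by simp), Finsupp.smul_sum]
    simp [mul_smul]

lemma plc_mem {A : Set V} {a : V} (ha : a ∈ A) : a ∈ PLC A := by
  refine ⟨Finsupp.single a 1, fun b => ?_, ?_, by simp, by simp⟩
  · classical
    rw [Finsupp.single_apply]; split_ifs <;> norm_num
  · intro b hb
    have := Finsupp.support_single_subset hb
    simp at this
    rwa [this]

lemma plc_mono {A B : Set V} (h : A ⊆ B) : PLC A ⊆ PLC B := by
  rintro x ⟨c, c0, cA, cn, rfl⟩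
  exact ⟨c, c0, cA.trans h, cn, rfl⟩

/-- Cone including zero. -/
def Cone (A : Set V) (v : V) : Prop := v = 0 ∨ v ∈ PLC A

lemma Cone.add {A : Set V} {x y : V} (hx : Cone A x) (hy : Cone A y) : Cone A (x + y) := by
  rcases hx with rfl | hx
  · simpa using hy
  · rcases hy with rfl | hy
    · right; simpa using hx
    · right; exact plc_add hx hy

lemma Cone.smul {A : Set V} {x : V} {r : ℝ} (hr : 0 ≤ r) (hx : Cone A x) : Cone A (r • x) := by
  rcases hx with rfl | hx
  · left; simp
  · rcases hr.eq_or_lt with rfl | hr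
    · left; simp
    · right; exact plc_smul hr hx

lemma plc_add_cone {A : Set V} {x y : V} (hx : x ∈ PLC A) (hy : Cone A y) : x + y ∈ PLC A := by
  rcases hy with rfl | hy
  · simpa using hx
  · exact plc_add hx hy

lemma plc_split {A : Set V} {v : V} (a : V) (hv : v ∈ PLC A) :
    ∃ r : ℝ, 0 ≤ r ∧ ∃ e, Cone (A \ {a}) e ∧ v = r • a + e := by
  classical
  obtain ⟨c, c0, cA, cn, rfl⟩ := hv
  refine ⟨c a, c0 a, (c.erase a).sum fun b t => t • b, ?_, ?_⟩
  · by_cases h : c.erase a = 0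
    · left; simp [h]
    · right
      refine ⟨c.erase a, fun b => ?_, ?_, h, rfl⟩
      · rw [Finsupp.erase_apply]; split_ifs
        · exact le_rfl
        · exact c0 b
      · intro b hb
        rw [Finsupp.support_erase] at hb
        simp only [Finset.coe_erase, Set.mem_sdiff, Set.mem_singleton_iff] at hb
        exact ⟨cA hb.1, hb.2⟩
  · conv_lhs => rw [← Finsupp.single_add_erase a c]
    rw [Finsupp.sum_add_index' (by simp) (by intros; rw [add_smul])]
    simp

variable {S : Type*} {α : S → V}

lemma quad_left (hα : Function.Injective α) (D2a : (0 : V) ∉ PLC (Set.range α))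
    (D2c : ∀ s, α s ∉ PLC (Set.range α \ {α s})) {s t : S} (hst : s ≠ t) {x y : ℝ}
    (h : x • α s + y • α t ∈ PLC (Set.range α)) : 0 ≤ x := by
  by_contra hx
  push Not at hx
  obtain ⟨r, hr, e, he, hE⟩ := plc_split (α t) h
  have hmem : α s ∈ Set.range α \ {α t} := ⟨⟨s, rfl⟩, fun h' => hst (hα h')⟩
  have hP : (-x) • α s + e ∈ PLC (Set.range α \ {α t}) :=
    plc_add_cone (plc_smul (by linarith) (plc_mem hmem)) he
  have hEq : (y - r) • α t = (-x) • α s + e := by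
    linear_combination (norm := module) hE
  rcases lt_or_ge 0 (y - r) with h1 | h1
  · apply D2c t
    have := plc_smul (inv_pos.2 h1) hP
    rw [← hEq, smul_smul, inv_mul_cancel₀ h1.ne', one_smul] at this
    exact this
  · apply D2a
    have h2 : Cone (Set.range α) ((r - y) • α t) :=
      Cone.smul (by linarith) (Or.inr (plc_mem ⟨t, rfl⟩))
    have h3 := plc_add_cone (plc_mono Set.sdiff_subset hP) h2
    rw [← hEq, ← add_smul] at h3
    simpa using h3

lemma quad (hα : Function.Injective α) (D2a : (0 : V) ∉ PLC (Set.range α))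
    (D2c : ∀ s, α s ∉ PLC (Set.range α \ {α s})) {s t : S} (hst : s ≠ t) {x y : ℝ}
    (h : x • α s + y • α t ∈ PLC (Set.range α)) : 0 ≤ x ∧ 0 ≤ y :=
  ⟨quad_left hα D2a D2c hst h, quad_left hα D2a D2c hst.symm (by rwa [add_comm] at h)⟩

end cone

/-- Chebyshev-like sequence. -/
def cheb (l : ℝ) : ℕ → ℝ
  | 0 => 0
  | 1 => 1
  | (n + 2) => 2 * l * cheb l (n + 1) - cheb l n

lemma cheb_sin (θ : ℝ) (n : ℕ) : Real.sin θ * cheb (Real.cos θ) n = Real.sin (n * θ) ∧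
    Real.sin θ * cheb (Real.cos θ) (n + 1) = Real.sin ((n + 1 : ℕ) * θ) := by
  induction n with
  | zero => simp [cheb]
  | succ n ih =>
    refine ⟨ih.2, ?_⟩
    have e1 : ((n + 1 + 1 : ℕ) : ℝ) * θ = (n + 1 : ℕ) * θ + θ := by push_cast; ring
    have e2 : (n : ℝ) * θ = (n + 1 : ℕ) * θ - θ := by push_cast; ring
    have h1 := ih.1
    rw [e2, Real.sin_sub] at h1
    rw [e1, Real.sin_add, cheb]
    linear_combination (2 * Real.cos θ) * ih.2 - h1

lemma cheb_ge {l : ℝ} (hl : 1 ≤ l) (n : ℕ) : 0 ≤ cheb l n ∧ cheb l n ≤ cheb l (n + 1) := by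
  induction n with
  | zero => simp [cheb]
  | succ n ih =>
    refine ⟨ih.1.trans ih.2, ?_⟩
    rw [cheb]
    nlinarith [ih.1, ih.2]

section words
variable {S V V' : Type*} [AddCommGroup V] [Module ℝ V] [AddCommGroup V'] [Module ℝ V']
  {pair : V →ₗ[ℝ] V' →ₗ[ℝ] ℝ} {α : S → V} {β : S → V'} {ρ : S → Module.End ℝ V}

lemma alt_apply (D1 : ∀ s, pair (α s) (β s) = 1)
    (hρ : ∀ s x, ρ s x = x - (2 * pair x (β s)) • α s) {s t : S} {l c d : ℝ}
    (hcd : c * d = 1) (ha : pair (α s) (β t) = -(l * c)) (hb : pair (α t) (β s) = -(l * d))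
    (k : ℕ) : ((alternatingWord s t k).map ρ).prod (α s) =
      if Even k then cheb l (k + 1) • α s + (c * cheb l k) • α t
      else cheb l k • α s + (c * cheb l (k + 1)) • α t := by
  induction k with
  | zero => simp [alternatingWord, cheb]
  | succ k ih =>
    rw [alternatingWord_succ', List.map_cons, List.prod_cons, Module.End.mul_apply, ih]
    by_cases hk : Even k
    · have hk' : ¬ Even (k + 1) := by simp [hk, parity_simps]
      simp only [hk, hk', if_true, if_false, hρ, map_add, map_smul, LinearMap.add_apply,
        LinearMap.smul_apply, smul_eq_mul, D1, ha, cheb]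
      module
    · have hk' : Even (k + 1) := by simpa [parity_simps] using hk
      simp only [hk, hk', if_true, if_false, hρ, map_add, map_smul, LinearMap.add_apply,
        LinearMap.smul_apply, smul_eq_mul, D1, hb, cheb]
      linear_combination (norm := module) ((2 * l * cheb l (k + 1)) * hcd) • α s

lemma alt_prod_pow {G : Type*} [Monoid G] (f : S → G) (s t : S) (m : ℕ) :
    ((alternatingWord s t (2 * m)).map f).prod = (f s * f t) ^ m := by
  induction m with
  | zero => simp [alternatingWord]
  | succ m ih =>
    have : 2 * (m + 1) = 2 * m + 1 + 1 := by ring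
    rw [this, alternatingWord_succ, alternatingWord_succ]
    simp [ih, pow_succ, mul_assoc]

/-- Numerical hypothesis. -/
def Num (pair : V →ₗ[ℝ] V' →ₗ[ℝ] ℝ) (α : S → V) (β : S → V') (M : CoxeterMatrix S) : Prop :=
  ∀ s t, s ≠ t → ∃ l c d : ℝ, 0 < c ∧ 0 < d ∧ c * d = 1 ∧ pair (α s) (β t) = -(l * c) ∧
    pair (α t) (β s) = -(l * d) ∧
    ((M s t = 0 ∧ 1 ≤ l) ∨ (2 ≤ M s t ∧ l = Real.cos (Real.pi / M s t)))

lemma rho_sq (D1 : ∀ s, pair (α s) (β s) = 1)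
    (hρ : ∀ s x, ρ s x = x - (2 * pair x (β s)) • α s) (s : S) : ρ s * ρ s = 1 := by
  ext x
  simp only [Module.End.mul_apply, hρ, map_sub, map_smul, LinearMap.sub_apply,
    LinearMap.smul_apply, smul_eq_mul, D1, Module.End.one_apply]
  module

lemma rho_self (D1 : ∀ s, pair (α s) (β s) = 1)
    (hρ : ∀ s x, ρ s x = x - (2 * pair x (β s)) • α s) (s : S) : ρ s (α s) = -α s := by
  rw [hρ, D1]; module

lemma sin_pos_m {m : ℕ} (hm : 2 ≤ m) : 0 < Real.sin (Real.pi / m) := by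
  have : (2 : ℝ) ≤ m := by exact_mod_cast hm
  apply Real.sin_pos_of_pos_of_lt_pi
  · have := Real.pi_pos; positivity
  · exact div_lt_self Real.pi_pos (by linarith)

lemma liftable {M : CoxeterMatrix S} (D1 : ∀ s, pair (α s) (β s) = 1)
    (hρ : ∀ s x, ρ s x = x - (2 * pair x (β s)) • α s) (hN : Num pair α β M) :
    M.IsLiftable ρ := by
  intro s t
  by_cases hst : s = t
  · subst hst
    rw [rho_sq D1 hρ, one_pow]
  obtain ⟨l, c, d, hc, hd, hcd, ha, hb, h | ⟨hm, hl⟩⟩ := hN s t hst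
  · rw [h.1, pow_zero]
  generalize M s t = m at hm hl
  have hs := sin_pos_m hm
  have hm0 : (m : ℝ) ≠ 0 := by positivity
  have v1 : cheb l (2 * m) = 0 := by
    have := (cheb_sin (Real.pi / m) (2 * m)).1
    rw [← hl, show ((2 * m : ℕ) : ℝ) * (Real.pi / m) = 2 * Real.pi by
      push_cast; field_simp, Real.sin_two_pi] at this
    exact (mul_eq_zero.1 this).resolve_left hs.ne'
  have v2 : cheb l (2 * m + 1) = 1 := by
    have := (cheb_sin (Real.pi / m) (2 * m)).2
    rw [← hl, show ((2 * m + 1 : ℕ) : ℝ) * (Real.pi / m) = Real.pi / m + 2 * Real.pi by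
      push_cast; field_simp; ring, Real.sin_add_two_pi] at this
    exact mul_left_cancel₀ hs.ne' (by rw [this, mul_one])
  obtain ⟨n, hn⟩ : ∃ n, 2 * m = n + 1 := ⟨2 * m - 1, by omega⟩
  have hno : ¬ Even n := by
    intro h
    have : ¬ Even (n + 1) := by simp [h, parity_simps]
    exact this (hn ▸ even_two_mul m)
  have v3 : cheb l n = -1 := by
    have h2 : cheb l (n + 1 + 1) = 2 * l * cheb l (n + 1) - cheb l n := rfl
    rw [← hn, v1, v2] at h2
    linarith
  have A1 : ((ρ s * ρ t) ^ m) (α s) = α s := by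
    rw [← alt_prod_pow, alt_apply D1 hρ hcd ha hb]
    simp [v1, v2]
  have A2 : ((ρ s * ρ t) ^ m) (α t) = α t := by
    rw [← alt_prod_pow, hn, alternatingWord_succ]
    simp only [List.concat_eq_append, List.map_append, List.prod_append, List.map_cons,
      List.map_nil, List.prod_singleton, Module.End.mul_apply]
    rw [rho_self D1 hρ, map_neg, alt_apply D1 hρ (by rw [mul_comm]; exact hcd) hb ha, if_neg hno,
      ← hn, v1, v3]
    simp
  have A3 : ∀ z, pair z (β s) = 0 → pair z (β t) = 0 → ((ρ s * ρ t) ^ m) z = z := by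
    intro z h1 h2
    have : (ρ s * ρ t) z = z := by simp [hρ, h1, h2]
    clear * - this
    induction m with
    | zero => simp
    | succ m ih => rw [pow_succ, Module.End.mul_apply, this, ih]
  have hdet : 1 - l ^ 2 ≠ 0 := by
    have := Real.sin_sq_add_cos_sq (Real.pi / m)
    rw [← hl] at this
    have h3 : 1 - l ^ 2 = Real.sin (Real.pi / m) ^ 2 := by linarith
    rw [h3]; positivity
  ext x
  set p := pair x (β s) with hp
  set q := pair x (β t) with hq
  set x1 := (p + l * d * q) / (1 - l ^ 2) with hx1
  set y1 := (q + l * c * p) / (1 - l ^ 2) with hy1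
  have hz := A3 (x - x1 • α s - y1 • α t) (by
      simp only [map_sub, map_smul, LinearMap.sub_apply, LinearMap.smul_apply, smul_eq_mul, D1,
        hb, ← hp, hx1, hy1]
      field_simp
      linear_combination (p * l ^ 2) * hcd) (by
      simp only [map_sub, map_smul, LinearMap.sub_apply, LinearMap.smul_apply, smul_eq_mul, D1,
        ha, ← hq, hx1, hy1]
      field_simp
      linear_combination (q * l ^ 2) * hcd)
  simp only [map_sub, map_smul, A1, A2] at hz
  simpa using hz

lemma alt_cone {M : CoxeterMatrix S} (D1 : ∀ s, pair (α s) (β s) = 1)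
    (hρ : ∀ s x, ρ s x = x - (2 * pair x (β s)) • α s) (hN : Num pair α β M) {s t : S}
    (hst : s ≠ t) (k : ℕ) (hk : M s t = 0 ∨ k < M s t) :
    ∃ x y : ℝ, 0 ≤ x ∧ 0 ≤ y ∧ ((alternatingWord s t k).map ρ).prod (α s) = x • α s + y • α t := by
  obtain ⟨l, c, d, hc, hd, hcd, ha, hb, h⟩ := hN s t hst
  have key : 0 ≤ cheb l k ∧ 0 ≤ cheb l (k + 1) := by
    rcases h with ⟨h, hl⟩ | ⟨hm, hl⟩
    · exact ⟨(cheb_ge hl k).1, (cheb_ge hl (k + 1)).1⟩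
    · have hkm : k < M s t := by omega
      generalize M s t = m at hm hl hkm
      have hs := sin_pos_m hm
      have hm0 : (0 : ℝ) < m := by positivity
      have aux : ∀ j : ℕ, j ≤ m → 0 ≤ Real.sin (j * (Real.pi / m)) := by
        intro j hj
        have hj' : (j : ℝ) ≤ m := by exact_mod_cast hj
        apply Real.sin_nonneg_of_nonneg_of_le_pi
        · have := Real.pi_pos; positivity
        · rw [mul_div_assoc', div_le_iff₀ hm0]
          nlinarith [Real.pi_pos]
      have h1 := cheb_sin (Real.pi / m) k
      rw [← hl] at h1
      constructor
      · have := aux k hkm.le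
        rw [← h1.1] at this
        exact nonneg_of_mul_nonneg_right this hs
      · have := aux (k + 1) hkm
        rw [← h1.2] at this
        exact nonneg_of_mul_nonneg_right this hs
  rw [alt_apply D1 hρ hcd ha hb]
  split_ifs
  · exact ⟨_, _, key.2, mul_nonneg hc.le key.1, rfl⟩
  · exact ⟨_, _, key.1, mul_nonneg hc.le key.2, rfl⟩

lemma map_wordProd {M : CoxeterMatrix S} {W G : Type*} [Group W] [Monoid G]
    (cs : CoxeterSystem M W) (F : W →* G) (f : S → G) (hF : ∀ s, F (cs.simple s) = f s)
    (L : List S) : F (cs.wordProd L) = (L.map f).prod := by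
  induction L with
  | nil => simp
  | cons a L ih => simp [cs.wordProd_cons, ih, hF]

lemma pos_root {M : CoxeterMatrix S} {W : Type*} [Group W] (cs : CoxeterSystem M W)
    (D1 : ∀ s, pair (α s) (β s) = 1)
    (hρ : ∀ s x, ρ s x = x - (2 * pair x (β s)) • α s) (hN : Num pair α β M)
    (F : W →* Module.End ℝ V) (hF : ∀ s, F (cs.simple s) = ρ s) (n : ℕ) :
    ∀ (w : W), cs.length w = n → ∀ s, ¬ cs.IsRightDescent w s →
      Cone (Set.range α) (F w (α s)) := by
  induction n using Nat.strong_induction_on with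
  | _ n ih =>
  intro w hw s hs
  by_cases h1 : w = 1
  · subst h1; right; simpa using plc_mem (Set.mem_range_self (f := α) s)
  obtain ⟨t, ht⟩ := cs.exists_rightDescent_of_ne_one h1
  have hst : s ≠ t := by rintro rfl; exact hs ht
  -- maximal alternating suffix
  let P : ℕ → Prop := fun k => ∃ v, w = v * cs.wordProd (alternatingWord s t k) ∧
    cs.length w = cs.length v + k
  have P1 : P 1 := by
    refine ⟨w * cs.simple t, by simp [alternatingWord], ?_⟩
    exact (cs.isRightDescent_iff.1 ht).symm
  have Pb : ∀ k, P k → k ≤ n := by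
    rintro k ⟨v, -, h⟩; omega
  obtain ⟨k, hk1, ⟨v, hwv, hlen⟩, hmax⟩ : ∃ k, 1 ≤ k ∧ P k ∧ ¬ P (k + 1) := by
    by_contra hcon
    push Not at hcon
    have : ∀ k, P (k + 1) := by
      intro k
      induction k with
      | zero => exact P1
      | succ k ihk => exact hcon (k + 1) (by omega) ihk
    have := Pb _ (this n)
    omega
  obtain ⟨j, rfl⟩ : ∃ j, k = j + 1 := ⟨k - 1, by omega⟩
  have hq : ¬ cs.IsRightDescent v (if Even (j + 1) then t else s) := by
    intro h
    apply hmax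
    refine ⟨v * cs.simple (if Even (j + 1) then t else s), ?_, ?_⟩
    · rw [alternatingWord_succ' s t (j + 1), cs.wordProd_cons, mul_assoc,
        cs.simple_mul_simple_cancel_left, ← hwv]
    · have := cs.isRightDescent_iff.1 h
      omega
  have hp : ¬ cs.IsRightDescent v (if Even j then t else s) := by
    intro h
    have h2 := cs.isRightDescent_iff.1 h
    have h3 : w = (v * cs.simple (if Even j then t else s)) *
        cs.wordProd (alternatingWord s t j) := by
      rw [hwv, alternatingWord_succ' s t j, cs.wordProd_cons, mul_assoc]
    have h4 := cs.length_mul_le (v * cs.simple (if Even j then t else s))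
      (cs.wordProd (alternatingWord s t j))
    rw [← h3] at h4
    have h5 := cs.length_wordProd_le (alternatingWord s t j)
    rw [length_alternatingWord] at h5
    omega
  have hvs : ¬ cs.IsRightDescent v s ∧ ¬ cs.IsRightDescent v t := by
    by_cases hj : Even j
    · have hj' : ¬ Even (j + 1) := by simp [hj, parity_simps]
      rw [if_neg hj'] at hq
      rw [if_pos hj] at hp
      exact ⟨hq, hp⟩
    · have hj' : Even (j + 1) := by simpa [parity_simps] using hj
      rw [if_pos hj'] at hq
      rw [if_neg hj] at hp
      exact ⟨hp, hq⟩
  have hkm : M s t = 0 ∨ j + 1 < M s t := by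
    by_contra hcon
    push Not at hcon
    rcases hcon.2.lt_or_eq with h | h
    · have h2 := cs.not_isReduced_alternatingWord s t hcon.1 h
      have h3 := cs.length_wordProd_le (alternatingWord s t (j + 1))
      have h4 := cs.length_mul_le v (cs.wordProd (alternatingWord s t (j + 1)))
      rw [← hwv] at h4
      unfold CoxeterSystem.IsReduced at h2
      rw [length_alternatingWord] at h2 h3
      omega
    · have h2 := cs.wordProd_braidWord_eq s t
      unfold braidWord at h2
      rw [M.symmetric t s, h] at h2
      rw [h2, alternatingWord_succ] at hwv
      simp only [List.concat_eq_append, cs.wordProd_append, cs.wordProd_singleton] at hwv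
      apply hs
      unfold CoxeterSystem.IsRightDescent
      have h5 : w * cs.simple s = v * cs.wordProd (alternatingWord s t j) := by
        rw [hwv]; simp [mul_assoc]
      have h3 := cs.length_wordProd_le (alternatingWord s t j)
      have h4 := cs.length_mul_le v (cs.wordProd (alternatingWord s t j))
      rw [length_alternatingWord] at h3
      rw [h5]
      omega
  obtain ⟨x, y, hx, hy, hxy⟩ := alt_cone D1 hρ hN hst (j + 1) hkm
  rw [hwv, map_mul, Module.End.mul_apply, map_wordProd cs F ρ hF, hxy, map_add, map_smul, map_smul]
  have hv : cs.length v < n := by omega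
  exact ((ih _ hv v rfl s hvs.1).smul hx).add ((ih _ hv v rfl t hvs.2).smul hy)

theorem main_iso {M : CoxeterMatrix S} {W : Type*} [Group W] (cs : CoxeterSystem M W)
    (D1 : ∀ s, pair (α s) (β s) = 1) (D2a : (0 : V) ∉ PLC (Set.range α))
    (hρ : ∀ s x, ρ s x = x - (2 * pair x (β s)) • α s) (hN : Num pair α β M) :
    ∃ f : W ≃* Submonoid.closure (Set.range ρ),
      ∀ s : S, (f (cs.simple s) : Module.End ℝ V) = ρ s := by
  let F : W →* Module.End ℝ V := cs.lift ⟨ρ, liftable D1 hρ hN⟩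
  have hF : ∀ s, F (cs.simple s) = ρ s := fun s => cs.lift_apply_simple _ s
  have hinj : Function.Injective F := by
    rw [injective_iff_map_eq_one]
    intro w hw
    by_contra hne
    obtain ⟨t, ht⟩ := cs.exists_rightDescent_of_ne_one hne
    have h1 := pos_root cs D1 hρ hN F hF _ (w * cs.simple t) rfl t
      (cs.isRightDescent_iff_not_isRightDescent_mul.1 ht)
    rw [map_mul, hw, one_mul, hF, rho_self D1 hρ] at h1
    apply D2a
    have := plc_add_cone (plc_mem (Set.mem_range_self (f := α) t)) h1
    simpa using this
  have hrange : MonoidHom.mrange F = Submonoid.closure (Set.range ρ) := by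
    rw [MonoidHom.mrange_eq_map, ← cs.submonoid_closure_range_simple, MonoidHom.map_mclosure,
      ← Set.range_comp]
    congr 2
    ext s : 1
    exact hF s
  have hmem : ∀ w, F w ∈ Submonoid.closure (Set.range ρ) := fun w => hrange ▸ ⟨w, rfl⟩
  refine ⟨MulEquiv.ofBijective (F.codRestrict _ hmem) ⟨?_, ?_⟩, ?_⟩
  · intro a b hab
    exact hinj (congrArg Subtype.val hab)
  · rintro ⟨g, hg⟩
    rw [← hrange] at hg
    obtain ⟨w, hw⟩ := hg
    exact ⟨w, Subtype.ext hw⟩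
  · intro s
    exact hF s

theorem num_of_roots {M : CoxeterMatrix S} (hα : Function.Injective α)
    (D1 : ∀ s, pair (α s) (β s) = 1) (D2a : (0 : V) ∉ PLC (Set.range α))
    (D2c : ∀ s, α s ∉ PLC (Set.range α \ {α s}))
    (hρ : ∀ s x, ρ s x = x - (2 * pair x (β s)) • α s)
    (hroots : ∀ w ∈ Submonoid.closure (Set.range ρ), ∀ s,
      w (α s) ∈ PLC (Set.range α) ∨ -(w (α s)) ∈ PLC (Set.range α))
    (hM : ∀ s t : S, s ≠ t →
      ((2 ≤ M s t ∧
          pair (α s) (β t) * pair (α t) (β s) = Real.cos (Real.pi / (M s t)) ^ 2) ∨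
        (M s t = 0 ∧ ¬ ∃ m : ℕ, 2 ≤ m ∧
          pair (α s) (β t) * pair (α t) (β s) = Real.cos (Real.pi / m) ^ 2))) :
    Num pair α β M := by
  have hmem : ∀ s, ρ s ∈ Submonoid.closure (Set.range ρ) :=
    fun s => Submonoid.subset_closure ⟨s, rfl⟩
  have hsign : ∀ s t, s ≠ t → ∀ r, ∀ w ∈ Submonoid.closure (Set.range ρ), ∀ x y : ℝ,
      w (α r) = x • α s + y • α t → (0 ≤ x ∧ 0 ≤ y) ∨ (x ≤ 0 ∧ y ≤ 0) := by
    intro s t hst r w hw x y h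
    rcases hroots w hw r with h1 | h1
    · left
      rw [h] at h1
      exact quad hα D2a D2c hst h1
    · right
      have h2 : -(w (α r)) = (-x) • α s + (-y) • α t := by rw [h]; module
      rw [h2] at h1
      have := quad hα D2a D2c hst h1
      constructor <;> linarith
  have hneg : ∀ s t, s ≠ t → pair (α s) (β t) ≤ 0 := by
    intro s t hst
    have := hsign s t hst s (ρ t) (hmem t) 1 (-(2 * pair (α s) (β t))) (by rw [hρ]; module)
    rcases this with h | h <;> linarith [h.1, h.2]
  have hzero : ∀ s t, s ≠ t → pair (α s) (β t) = 0 → pair (α t) (β s) = 0 := by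
    intro s t hst h0
    have h1 := hsign s t hst t (ρ t * ρ s) (mul_mem (hmem t) (hmem s))
      (-(2 * pair (α t) (β s))) (-1) (by
        simp only [Module.End.mul_apply, hρ, map_sub, map_smul, LinearMap.sub_apply,
          LinearMap.smul_apply, smul_eq_mul, D1, h0]
        module)
    have h2 := hneg t s hst.symm
    rcases h1 with h | h <;> linarith [h.1, h.2]
  intro s t hst
  obtain ⟨l, c, d, hl, hc, hd, hcd, ha, hb⟩ : ∃ l c d : ℝ, 0 ≤ l ∧ 0 < c ∧ 0 < d ∧ c * d = 1 ∧
      pair (α s) (β t) = -(l * c) ∧ pair (α t) (β s) = -(l * d) := by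
    have ha := hneg s t hst
    have hb := hneg t s hst.symm
    by_cases h0 : pair (α s) (β t) = 0
    · exact ⟨0, 1, 1, le_rfl, one_pos, one_pos, by norm_num, by simpa using h0,
        by simpa using hzero s t hst h0⟩
    · have h1 : pair (α t) (β s) ≠ 0 := fun h => h0 (hzero t s hst.symm h)
      generalize pair (α s) (β t) = a at *
      generalize pair (α t) (β s) = b at *
      have ha' : 0 < -a := by
        rcases ha.lt_or_eq with h | h
        · linarith
        · exact absurd h h0
      have hb' : 0 < -b := by
        rcases hb.lt_or_eq with h | h
        · linarith
        · exact absurd h h1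
      obtain ⟨x, hx, hxa⟩ : ∃ x : ℝ, 0 < x ∧ -a = x ^ 2 :=
        ⟨Real.sqrt (-a), Real.sqrt_pos.2 ha', (Real.sq_sqrt ha'.le).symm⟩
      obtain ⟨y, hy, hyb⟩ : ∃ x : ℝ, 0 < x ∧ -b = x ^ 2 :=
        ⟨Real.sqrt (-b), Real.sqrt_pos.2 hb', (Real.sq_sqrt hb'.le).symm⟩
      refine ⟨x * y, x / y, y / x, by positivity, by positivity, by positivity, by field_simp,
        ?_, ?_⟩
      · field_simp; linarith
      · field_simp; linarith
  refine ⟨l, c, d, hc, hd, hcd, ha, hb, ?_⟩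
  have hprod : pair (α s) (β t) * pair (α t) (β s) = l ^ 2 := by
    rw [ha, hb]; linear_combination (l ^ 2) * hcd
  rcases hM s t hst with ⟨hm, h⟩ | ⟨hm, h⟩
  · right
    refine ⟨hm, ?_⟩
    rw [hprod] at h
    have hm' : (2 : ℝ) ≤ M s t := by exact_mod_cast hm
    have hcos : 0 ≤ Real.cos (Real.pi / M s t) := by
      apply Real.cos_nonneg_of_neg_pi_div_two_le_of_le
      · have := Real.pi_pos
        have : 0 ≤ Real.pi / M s t := by positivity
        linarith
      · exact div_le_div_of_nonneg_left Real.pi_pos.le (by norm_num) hm'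
    exact (pow_left_inj₀ hl hcos two_ne_zero).1 h
  · left
    refine ⟨hm, ?_⟩
    by_contra hl1
    push Not at hl1
    apply h
    rw [hprod]
    have hlc : Real.cos (Real.arccos l) = l := Real.cos_arccos (by linarith) hl1.le
    have hθ0 : 0 < Real.arccos l := Real.arccos_pos.2 hl1
    have hθ1 : Real.arccos l ≤ Real.pi / 2 := Real.arccos_le_pi_div_two.2 hl
    generalize Real.arccos l = θ at hlc hθ0 hθ1
    have hpi := Real.pi_pos
    have hs : 0 < Real.sin θ := Real.sin_pos_of_pos_of_lt_pi hθ0 (by linarith)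
    have hcs : ∀ k : ℕ, (0 ≤ cheb l k ∧ 0 ≤ cheb l (k + 1)) ∨
        (cheb l k ≤ 0 ∧ cheb l (k + 1) ≤ 0) := by
      intro k
      have hw : ((alternatingWord s t k).map ρ).prod ∈ Submonoid.closure (Set.range ρ) := by
        apply Submonoid.list_prod_mem
        intro x hx
        obtain ⟨a, -, rfl⟩ := List.mem_map.1 hx
        exact hmem a
      have h1 := alt_apply D1 hρ hcd ha hb k
      have hc1 : ∀ z, 0 ≤ c * z ↔ 0 ≤ z := fun z => mul_nonneg_iff_of_pos_left hc
      have hc2 : ∀ z, c * z ≤ 0 ↔ z ≤ 0 := fun z => by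
        constructor <;> intro hz <;> nlinarith
      by_cases hk : Even k
      · rw [if_pos hk] at h1
        have := hsign s t hst s _ hw _ _ h1
        rw [hc1, hc2] at this
        tauto
      · rw [if_neg hk] at h1
        have := hsign s t hst s _ hw _ _ h1
        rw [hc1, hc2] at this
        exact this
    have hNex : ∃ N : ℕ, Real.pi ≤ N * θ := by
      obtain ⟨N, hN⟩ := exists_nat_ge (Real.pi / θ)
      exact ⟨N, (div_le_iff₀ hθ0).1 hN⟩
    classical
    obtain ⟨N, hN1, hN2⟩ : ∃ N : ℕ, Real.pi ≤ (N + 1 : ℕ) * θ ∧ N * θ < Real.pi := by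
      have h1 := Nat.find_spec hNex
      have h2 := fun k => @Nat.find_min _ _ hNex k
      obtain ⟨j, hj⟩ : ∃ j, Nat.find hNex = j + 1 := by
        apply Nat.exists_eq_succ_of_ne_zero
        intro h0
        rw [h0] at h1
        simp at h1
        linarith
      rw [hj] at h1
      exact ⟨j, h1, not_le.1 (h2 j (by omega))⟩
    have hN0 : 1 ≤ N := by
      by_contra h0
      have : N = 0 := by omega
      subst this
      simp at hN1
      linarith
    have hN0' : (1 : ℝ) ≤ N := by exact_mod_cast hN0
    refine ⟨N + 1, by omega, ?_⟩
    have hθ : θ = Real.pi / (N + 1 : ℕ) := by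
      rw [eq_div_iff (by positivity), mul_comm]
      by_contra hne
      have hlt := lt_of_le_of_ne hN1 (Ne.symm hne)
      have s1 : 0 < Real.sin (N * θ) := Real.sin_pos_of_pos_of_lt_pi (by positivity) hN2
      have s2 : Real.sin ((N + 1 : ℕ) * θ) < 0 := by
        have h3 : 0 < Real.sin ((N + 1 : ℕ) * θ - Real.pi) := by
          apply Real.sin_pos_of_pos_of_lt_pi
          · linarith
          · push_cast at hN1 ⊢; linarith
        rw [Real.sin_sub_pi] at h3
        linarith
      have h4 := cheb_sin θ N
      rw [hlc] at h4
      rw [← h4.1] at s1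
      rw [← h4.2] at s2
      have t1 : 0 < cheb l N := pos_of_mul_pos_right s1 hs.le
      have t2 : cheb l (N + 1) < 0 := by nlinarith
      rcases hcs N with h | h <;> linarith [h.1, h.2]
    rw [← hθ, hlc]

end words

end Stmt8Aux

/-- Suppose (D1), (D2) hold and `Φ₁ = Φ₁⁺ ⊎ Φ₁⁻`.  Let `M` be the Coxeter
matrix on `S` with `M s s = 1`, `M s t = m` when `⟨αₛ, βₜ⟩⟨αₜ, βₛ⟩ = cos²(π/m)` for an
integer `m ≥ 2`, and `M s t = 0` (representing `∞`) otherwise, and let `(W, {rₛ})` be a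
Coxeter system of type `M` (so `W` is generated by the involutions `rₛ = cs.simple s`
subject only to the relations `(rₛ rₜ)^{M s t} = 1`).  Then there are group isomorphisms
`f₁ : W ≃* W₁` and `f₂ : W ≃* W₂` with `f₁ rₛ = ρ₁ s` and `f₂ rₛ = ρ₂ s` for all `s`,
where `Wᵢ` is the (sub)group generated by the involutions `ρᵢ s` inside the monoid of
linear endomorphisms. -/
theorem stmt8 {S V₁ V₂ : Type*} [AddCommGroup V₁] [Module ℝ V₁]
    [AddCommGroup V₂] [Module ℝ V₂]
    (pair : V₁ →ₗ[ℝ] V₂ →ₗ[ℝ] ℝ) (α : S → V₁) (β : S → V₂)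
    (hα : Function.Injective α) (hβ : Function.Injective β)
    (D1 : ∀ s, pair (α s) (β s) = 1)
    (D2a : (0 : V₁) ∉ PLC (Set.range α)) (D2b : (0 : V₂) ∉ PLC (Set.range β))
    (D2c : ∀ s, α s ∉ PLC (Set.range α \ {α s}))
    (D2d : ∀ s, β s ∉ PLC (Set.range β \ {β s}))
    (ρ₁ : S → Module.End ℝ V₁) (ρ₂ : S → Module.End ℝ V₂)
    (hρ₁ : ∀ s x, ρ₁ s x = x - (2 * pair x (β s)) • α s)
    (hρ₂ : ∀ s y, ρ₂ s y = y - (2 * pair (α s) y) • β s)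
    (Φ₁ : Set V₁)
    (hΦ₁ : Φ₁ = { v | ∃ w ∈ Submonoid.closure (Set.range ρ₁), ∃ s, v = w (α s) })
    (hdecomp : Φ₁ = (Φ₁ ∩ PLC (Set.range α)) ∪ (-(Φ₁ ∩ PLC (Set.range α))) ∧
      Disjoint (Φ₁ ∩ PLC (Set.range α)) (-(Φ₁ ∩ PLC (Set.range α))))
    (M : CoxeterMatrix S)
    (hM : ∀ s t : S, s ≠ t →
      ((2 ≤ M s t ∧
          pair (α s) (β t) * pair (α t) (β s) = Real.cos (Real.pi / (M s t)) ^ 2) ∨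
        (M s t = 0 ∧ ¬ ∃ m : ℕ, 2 ≤ m ∧
          pair (α s) (β t) * pair (α t) (β s) = Real.cos (Real.pi / m) ^ 2)))
    (W : Type*) [Group W] (cs : CoxeterSystem M W) :
    (∃ f₁ : W ≃* Submonoid.closure (Set.range ρ₁),
      ∀ s : S, (f₁ (cs.simple s) : Module.End ℝ V₁) = ρ₁ s) ∧
    (∃ f₂ : W ≃* Submonoid.closure (Set.range ρ₂),
      ∀ s : S, (f₂ (cs.simple s) : Module.End ℝ V₂) = ρ₂ s) := by
  have hroots : ∀ w ∈ Submonoid.closure (Set.range ρ₁), ∀ s,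
      w (α s) ∈ PLC (Set.range α) ∨ -(w (α s)) ∈ PLC (Set.range α) := by
    intro w hw s
    have h1 : w (α s) ∈ Φ₁ := by rw [hΦ₁]; exact ⟨w, hw, s, rfl⟩
    rw [hdecomp.1] at h1
    rcases h1 with h1 | h1
    · exact Or.inl h1.2
    · exact Or.inr (Set.mem_neg.1 h1).2
  have hN : Stmt8Aux.Num pair α β M :=
    Stmt8Aux.num_of_roots hα D1 D2a D2c hρ₁ hroots hM
  have hN' : Stmt8Aux.Num pair.flip β α M := by
    intro s t hst
    obtain ⟨l, c, d, hc, hd, hcd, ha, hb, h⟩ := hN s t hst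
    exact ⟨l, d, c, hd, hc, by rw [mul_comm]; exact hcd, by simpa using hb, by simpa using ha, h⟩
  exact ⟨Stmt8Aux.main_iso cs D1 D2a hρ₁ hN,
    Stmt8Aux.main_iso (pair := pair.flip) cs (by simpa using D1) D2b (by simpa using hρ₂) hN'⟩
end

section
/- Suppose Δ'₁ ⊆ Φ₁⁺ and Δ'₂ ⊆ Φ₂⁺ are such that: (A1) φ(Δ'₁) = Δ'₂; (A2) ⟨x, φ(x')⟩ ≤ 0 for all distinct x, x' ∈ Δ'₁; (A3) ⟨x, φ(x')⟩⟨x', φ(x)⟩ ∈ {cos²(π/m) : m ∈ ℤ, m ≥ 2} ∪ [1, ∞) for all x, x' ∈ Δ'₁ with r_x ≠ r_{x'}. Then W' := ⟨{r_x : x ∈ Δ'₁}⟩ is a reflection subgroup of W, and the sets of scalar-equivalence classes satisfy Δ̂'₁ = Δ̂₁(W') and Δ̂'₂ = Δ̂₂(W'). -/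
open Pointwise

/-- `altEnd a b m` is the alternating product `⋯ a b a b` … of `m` factors,
ending with `b` (e.g. `altEnd a b 3 = b * a * b`). -/
def altEnd {G : Type*} [Monoid G] : G → G → ℕ → G
  | _, _, 0 => 1
  | a, b, m + 1 => altEnd b a m * b

/-- The class of `z` under the equivalence "being nonzero scalar multiples of each
other" (the class `ẑ`). -/
def rayClass {V : Type*} [AddCommGroup V] [Module ℝ V] (z : V) : Set V :=
  { v | ∃ c : ℝ, c ≠ 0 ∧ v = c • z }

/-- The set `Â = {ẑ : z ∈ A}` of scalar-equivalence classes of elements of `A`. -/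
def rayClasses {V : Type*} [AddCommGroup V] [Module ℝ V] (A : Set V) : Set (Set V) :=
  { C | ∃ z ∈ A, C = rayClass z }

/-- A Coxeter datum `(S, V₁, V₂, Π₁, Π₂, ⟨·,·⟩)` satisfying (D1)–(D5), together with
its associated abstract Coxeter group `W` (a group generated by involutions
`r s`, acting faithfully on `V₁` and `V₂` in the prescribed way, with the pairing
`W`-invariant), the decomposition `Φᵢ = Φᵢ⁺ ⊎ Φᵢ⁻` of the paired root systems, the
`W`-equivariant bijection `φ : Φ₁ → Φ₂` (with inverse `phiInv`), and the reflections
`r_x ∈ T` attached to the roots `x ∈ Φ₁` (`refl₁`) resp. `y ∈ Φ₂` (`refl₂`). -/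
structure CoxeterDatum (S : Type*) (V₁ : Type*) (V₂ : Type*) (W : Type*)
    [AddCommGroup V₁] [Module ℝ V₁] [AddCommGroup V₂] [Module ℝ V₂] [Group W] where
  pair : V₁ →ₗ[ℝ] V₂ →ₗ[ℝ] ℝ
  α : S → V₁
  β : S → V₂
  α_inj : Function.Injective α
  β_inj : Function.Injective β
  D1 : ∀ s, pair (α s) (β s) = 1
  D2a : (0 : V₁) ∉ PLC (Set.range α)
  D2b : (0 : V₂) ∉ PLC (Set.range β)
  D2c : ∀ s, α s ∉ PLC (Set.range α \ {α s})
  D2d : ∀ s, β s ∉ PLC (Set.range β \ {β s})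
  D3 : ∀ s t, s ≠ t → pair (α s) (β t) ≤ 0
  D4 : ∀ s t, pair (α s) (β t) = 0 → pair (α t) (β s) = 0
  D5 : ∀ s t, s ≠ t →
    (∃ m : ℕ, 2 ≤ m ∧ pair (α s) (β t) * pair (α t) (β s) = Real.cos (Real.pi / m) ^ 2) ∨
      1 ≤ pair (α s) (β t) * pair (α t) (β s)
  /-- the Coxeter generators `R = {r s : s ∈ S}` of `W` -/
  r : S → W
  r_gen : Subgroup.closure (Set.range r) = ⊤
  r_ne_one : ∀ s, r s ≠ 1
  r_sq : ∀ s, r s * r s = 1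
  /-- the faithful action of `W` on `V₁` -/
  ρ₁ : W →* Module.End ℝ V₁
  /-- the faithful action of `W` on `V₂` -/
  ρ₂ : W →* Module.End ℝ V₂
  ρ₁_inj : Function.Injective ρ₁
  ρ₂_inj : Function.Injective ρ₂
  hr₁ : ∀ s x, ρ₁ (r s) x = x - (2 * pair x (β s)) • α s
  hr₂ : ∀ s y, ρ₂ (r s) y = y - (2 * pair (α s) y) • β s
  pair_inv : ∀ w x y, pair (ρ₁ w x) (ρ₂ w y) = pair x y
  /-- the `W`-equivariant bijection `φ : Φ₁ → Φ₂` -/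
  phi : V₁ → V₂
  /-- the inverse `φ⁻¹ : Φ₂ → Φ₁` -/
  phiInv : V₂ → V₁
  /-- the reflection `r_x` corresponding to a root `x ∈ Φ₁` -/
  refl₁ : V₁ → W
  /-- the reflection `r_y` corresponding to a root `y ∈ Φ₂` -/
  refl₂ : V₂ → W
  decomp₁ : { v | ∃ w s, v = ρ₁ w (α s) } =
      ({ v | ∃ w s, v = ρ₁ w (α s) } ∩ PLC (Set.range α)) ∪
        (-({ v | ∃ w s, v = ρ₁ w (α s) } ∩ PLC (Set.range α)))
  disj₁ : Disjoint ({ v | ∃ w s, v = ρ₁ w (α s) } ∩ PLC (Set.range α))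
      (-({ v | ∃ w s, v = ρ₁ w (α s) } ∩ PLC (Set.range α)))
  decomp₂ : { v | ∃ w s, v = ρ₂ w (β s) } =
      ({ v | ∃ w s, v = ρ₂ w (β s) } ∩ PLC (Set.range β)) ∪
        (-({ v | ∃ w s, v = ρ₂ w (β s) } ∩ PLC (Set.range β)))
  disj₂ : Disjoint ({ v | ∃ w s, v = ρ₂ w (β s) } ∩ PLC (Set.range β))
      (-({ v | ∃ w s, v = ρ₂ w (β s) } ∩ PLC (Set.range β)))
  phi_mem : ∀ x ∈ { v | ∃ w s, v = ρ₁ w (α s) }, phi x ∈ { v | ∃ w s, v = ρ₂ w (β s) }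
  phiInv_mem : ∀ y ∈ { v | ∃ w s, v = ρ₂ w (β s) }, phiInv y ∈ { v | ∃ w s, v = ρ₁ w (α s) }
  phiInv_phi : ∀ x ∈ { v | ∃ w s, v = ρ₁ w (α s) }, phiInv (phi x) = x
  phi_phiInv : ∀ y ∈ { v | ∃ w s, v = ρ₂ w (β s) }, phi (phiInv y) = y
  phi_simple : ∀ s, phi (α s) = β s
  phi_equiv : ∀ w, ∀ x ∈ { v | ∃ w s, v = ρ₁ w (α s) }, phi (ρ₁ w x) = ρ₂ w (phi x)
  refl₁_eq : ∀ w s, refl₁ (ρ₁ w (α s)) = w * r s * w⁻¹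
  refl₂_eq : ∀ w s, refl₂ (ρ₂ w (β s)) = w * r s * w⁻¹
  refl₁_act : ∀ x ∈ { v | ∃ w s, v = ρ₁ w (α s) }, ∀ v,
      ρ₁ (refl₁ x) v = v - (2 * pair v (phi x)) • x
  refl₂_act : ∀ y ∈ { v | ∃ w s, v = ρ₂ w (β s) }, ∀ v,
      ρ₂ (refl₂ y) v = v - (2 * pair (phiInv y) v) • y

namespace CoxeterDatum

variable {S V₁ V₂ W : Type*} [AddCommGroup V₁] [Module ℝ V₁]
  [AddCommGroup V₂] [Module ℝ V₂] [Group W]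

variable (D : CoxeterDatum S V₁ V₂ W)

/-- The root system `Φ₁ = W Π₁`. -/
def Phi₁ : Set V₁ := { v | ∃ w s, v = D.ρ₁ w (D.α s) }

/-- The root system `Φ₂ = W Π₂`. -/
def Phi₂ : Set V₂ := { v | ∃ w s, v = D.ρ₂ w (D.β s) }

/-- The positive roots `Φ₁⁺ = Φ₁ ∩ PLC Π₁`. -/
def PhiPos₁ : Set V₁ := D.Phi₁ ∩ PLC (Set.range D.α)

/-- The positive roots `Φ₂⁺ = Φ₂ ∩ PLC Π₂`. -/
def PhiPos₂ : Set V₂ := D.Phi₂ ∩ PLC (Set.range D.β)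

/-- The negative roots `Φ₁⁻ = -Φ₁⁺`. -/
def PhiNeg₁ : Set V₁ := -D.PhiPos₁

/-- The negative roots `Φ₂⁻ = -Φ₂⁺`. -/
def PhiNeg₂ : Set V₂ := -D.PhiPos₂

/-- The set `T = ⋃_{w ∈ W} w R w⁻¹` of reflections of `W`. -/
def T : Set W := { t | ∃ w s, t = w * D.r s * w⁻¹ }

/-- The length function `ℓ` of `W` with respect to the Coxeter generators `R`. -/
noncomputable def len (w : W) : ℕ :=
  sInf { n | ∃ l : List S, l.length = n ∧ (l.map D.r).prod = w }

/-- `N̄ w = {t ∈ T : ℓ(w t) < ℓ(w)}`. -/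
noncomputable def Nbar (w : W) : Set W :=
  { t | t ∈ D.T ∧ D.len (w * t) < D.len w }

/-- `N₁ w = {ẑ : z ∈ Φ₁⁺, w z ∈ Φ₁⁻}`. -/
def N₁ (w : W) : Set (Set V₁) :=
  { C | ∃ z, z ∈ D.PhiPos₁ ∧ D.ρ₁ w z ∈ D.PhiNeg₁ ∧ C = rayClass z }

/-- `N₂ w = {ẑ : z ∈ Φ₂⁺, w z ∈ Φ₂⁻}`. -/
def N₂ (w : W) : Set (Set V₂) :=
  { C | ∃ z, z ∈ D.PhiPos₂ ∧ D.ρ₂ w z ∈ D.PhiNeg₂ ∧ C = rayClass z }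

/-- A subgroup `W'` of `W` is a reflection subgroup when `W' = ⟨W' ∩ T⟩`. -/
def IsReflectionSubgroup (W' : Subgroup W) : Prop :=
  W' = Subgroup.closure ((W' : Set W) ∩ D.T)

/-- `Φ₁(W') = {x ∈ Φ₁ : r_x ∈ W'}`. -/
def PhiSub₁ (W' : Subgroup W) : Set V₁ :=
  { x | x ∈ D.Phi₁ ∧ D.refl₁ x ∈ W' }

/-- `Φ₂(W') = {y ∈ Φ₂ : r_y ∈ W'}`. -/
def PhiSub₂ (W' : Subgroup W) : Set V₂ :=
  { y | y ∈ D.Phi₂ ∧ D.refl₂ y ∈ W' }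

/-- The canonical generators `S(W') = {t ∈ T : N̄(t) ∩ W' = {t}}`. -/
noncomputable def SW (W' : Subgroup W) : Set W :=
  { t | t ∈ D.T ∧ D.Nbar t ∩ (W' : Set W) = {t} }

/-- `Δ₁(W') = {x ∈ Φ₁⁺ : r_x ∈ S(W')}`. -/
noncomputable def Delta₁ (W' : Subgroup W) : Set V₁ :=
  { x | x ∈ D.PhiPos₁ ∧ D.refl₁ x ∈ D.SW W' }

/-- `Δ₂(W') = {y ∈ Φ₂⁺ : r_y ∈ S(W')}`. -/
noncomputable def Delta₂ (W' : Subgroup W) : Set V₂ :=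
  { y | y ∈ D.PhiPos₂ ∧ D.refl₂ y ∈ D.SW W' }

/-- The length function `ℓ_{W'}` of a reflection subgroup `W'` with respect to its
canonical generators `S(W')`. -/
noncomputable def lenIn (W' : Subgroup W) (w : W) : ℕ :=
  sInf { n | ∃ l : List W, l.length = n ∧ (∀ t ∈ l, t ∈ D.SW W') ∧ l.prod = w }

end CoxeterDatum
namespace CoxAux

open scoped NNReal

section cone
variable {V : Type*} [AddCommGroup V] [Module ℝ V]

/-- nonnegative cone -/
abbrev cone (A : Set V) : Submodule ℝ≥0 V := Submodule.span ℝ≥0 A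

theorem smul_mem_cone {A : Set V} {v : V} (hv : v ∈ cone A) {c : ℝ} (hc : 0 ≤ c) :
    c • v ∈ cone A := by
  have := (cone A).smul_mem (⟨c, hc⟩ : ℝ≥0) hv
  exact this

theorem cone_le_PLC {A : Set V} {v : V} (hv : v ∈ cone A) :
    ∃ c : V →₀ ℝ, (∀ a, 0 ≤ c a) ∧ ↑c.support ⊆ A ∧ v = c.sum fun a t => t • a := by
  classical
  induction hv using Submodule.span_induction with
  | mem a ha =>
    refine ⟨Finsupp.single a 1, ?_, ?_, ?_⟩
    · intro b
      by_cases h : a = b <;> simp [h]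
    · intro b hb
      have := Finsupp.support_single_subset (Finset.mem_coe.1 hb)
      simp at this
      exact this ▸ ha
    · simp
  | zero => exact ⟨0, by simp, by simp, by simp⟩
  | add u v _ _ hu hv =>
    obtain ⟨c, hc, hs, rfl⟩ := hu
    obtain ⟨d, hd, ht, rfl⟩ := hv
    refine ⟨c + d, fun a => add_nonneg (hc a) (hd a), ?_, ?_⟩
    · intro b hb
      rcases Finset.mem_union.1 (Finsupp.support_add (Finset.mem_coe.1 hb)) with h | h
      · exact hs h
      · exact ht h
    · rw [Finsupp.sum_add_index'] <;> simp [add_smul]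
  | smul k v _ hv =>
    obtain ⟨c, hc, hs, rfl⟩ := hv
    refine ⟨(k : ℝ) • c, fun a => mul_nonneg k.2 (hc a), ?_, ?_⟩
    · intro b hb
      exact hs (Finsupp.support_smul (Finset.mem_coe.1 hb))
    · rw [Finsupp.sum_smul_index' (by simp), Finsupp.smul_sum]
      simp only [smul_assoc]
      rfl

theorem mem_PLC_of {A : Set V} {v : V} (hv : v ∈ cone A) (h0 : v ≠ 0) : v ∈ PLC A := by
  obtain ⟨c, h1, h2, h3⟩ := cone_le_PLC hv
  refine ⟨c, h1, h2, ?_, h3⟩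
  rintro rfl
  simp at h3
  exact h0 h3

theorem mem_cone_of {A : Set V} {v : V} (hv : v ∈ PLC A) : v ∈ cone A := by
  obtain ⟨c, h1, h2, _, rfl⟩ := hv
  refine Submodule.sum_mem _ fun a ha => ?_
  exact smul_mem_cone (Submodule.subset_span (h2 ha)) (h1 a)

theorem pointed {A : Set V} (h0 : (0 : V) ∉ PLC A) {u : V} (hu : u ∈ cone A)
    (hv : -u ∈ cone A) : u = 0 := by
  by_contra hne
  obtain ⟨c, hc, hs, hcs⟩ := cone_le_PLC hu
  obtain ⟨d, hd, ht, hds⟩ := cone_le_PLC hv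
  apply h0
  classical
  refine ⟨c + d, fun a => add_nonneg (hc a) (hd a), ?_, ?_, ?_⟩
  · intro b hb
    rcases Finset.mem_union.1 (Finsupp.support_add (Finset.mem_coe.1 hb)) with h | h
    · exact hs h
    · exact ht h
  · intro h
    have : c = 0 := by
      ext a
      have h1 := DFunLike.congr_fun h a
      simp at h1
      have := hc a
      have := hd a
      simp; linarith
    rw [this] at hcs
    simp at hcs
    exact hne hcs
  · rw [Finsupp.sum_add_index', ← hcs, ← hds] <;> simp [add_smul]

theorem prop_of {A : Set V} (hp : ∀ u ∈ cone A, -u ∈ cone A → u = 0) (f : V →ₗ[ℝ] ℝ) {x : V}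
    (hx : x ∈ A) (hfx : f x = 1) (hf : ∀ a ∈ A, a ≠ x → f a ≤ 0) {z : V} (hz : z ∈ cone A)
    {k : ℝ} (hk : -(z - k • x) ∈ cone A) : ∃ p : ℝ, z = p • x := by
  have key : ∀ u ∈ cone A, ∃ p : ℝ, 0 ≤ p ∧ ∃ u' ∈ cone A, f u' ≤ 0 ∧ u = p • x + u' := by
    intro u hu
    induction hu using Submodule.span_induction with
    | mem a ha =>
      by_cases h : a = x
      · exact ⟨1, zero_le_one, 0, Submodule.zero_mem _, by simp, by simp [h]⟩
      · exact ⟨0, le_rfl, a, Submodule.subset_span ha, hf a ha h, by simp⟩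
    | zero => exact ⟨0, le_rfl, 0, Submodule.zero_mem _, by simp, by simp⟩
    | add u v _ _ hu hv =>
      obtain ⟨p, hp, u', h1, h2, rfl⟩ := hu
      obtain ⟨q, hq, v', h3, h4, rfl⟩ := hv
      refine ⟨p + q, add_nonneg hp hq, u' + v', Submodule.add_mem _ h1 h3, ?_, by module⟩
      rw [map_add]; linarith
    | smul c v _ hv =>
      obtain ⟨q, hq, v', h3, h4, rfl⟩ := hv
      refine ⟨c * q, mul_nonneg c.2 hq, c • v', Submodule.smul_mem _ _ h3, ?_, ?_⟩
      · have : f (c • v') = (c : ℝ) * f v' := by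
          rw [NNReal.smul_def, map_smul, smul_eq_mul]
        rw [this]
        exact mul_nonpos_of_nonneg_of_nonpos c.2 h4
      · rw [NNReal.smul_def, NNReal.smul_def]; module
  have hxc : x ∈ cone A := Submodule.subset_span hx
  obtain ⟨p, hp0, z', hz', hfz, rfl⟩ := key z hz
  obtain ⟨q, hq0, d', hd', hfd, hd⟩ := key _ hk
  have e : z' + d' = (k - p - q) • x := by
    have : d' = -(p • x + z' - k • x) - q • x := by rw [hd]; module
    rw [this]; module
  have hle : k - p - q ≤ 0 := by
    have := congrArg f e
    rw [map_add, map_smul, hfx] at this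
    simp at this
    linarith
  have hz0 : z' = 0 := by
    apply hp _ hz'
    have : -z' = d' + (-(k - p - q)) • x := by
      have : d' = (k - p - q) • x - z' := by rw [← e]; module
      rw [this]; module
    rw [this]
    exact Submodule.add_mem _ hd' (smul_mem_cone hxc (by linarith))
  exact ⟨p, by rw [hz0]; simp⟩

end cone

section words
variable {G : Type*} [Group G] {I : Type*} (r : I → G)

/-- word length -/
noncomputable def wlen (w : G) : ℕ :=
  sInf { n | ∃ l : List I, l.length = n ∧ (l.map r).prod = w }

/-- being a product of generators -/
def IsWord (w : G) : Prop := ∃ l : List I, (l.map r).prod = w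

variable {r}

theorem wlen_le (l : List I) {w : G} (h : (l.map r).prod = w) : wlen r w ≤ l.length :=
  Nat.sInf_le ⟨l, rfl, h⟩

theorem IsWord.exists_word {w : G} (h : IsWord r w) :
    ∃ l : List I, l.length = wlen r w ∧ (l.map r).prod = w := by
  obtain ⟨l, hl⟩ := h
  exact Nat.sInf_mem (s := { n | ∃ l : List I, l.length = n ∧ (l.map r).prod = w })
    ⟨l.length, l, rfl, hl⟩

theorem IsWord.mul {w u : G} (h : IsWord r w) (hu : IsWord r u) : IsWord r (w * u) := by
  obtain ⟨l, rfl⟩ := h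
  obtain ⟨l', rfl⟩ := hu
  exact ⟨l ++ l', by simp⟩

theorem isWord_gen (i : I) : IsWord r (r i) := ⟨[i], by simp⟩

theorem wlen_mul_le {w u : G} (h : IsWord r w) (hu : IsWord r u) :
    wlen r (w * u) ≤ wlen r w + wlen r u := by
  obtain ⟨l, hl, h1⟩ := h.exists_word
  obtain ⟨l', hl', h2⟩ := hu.exists_word
  rw [← hl, ← hl', ← List.length_append]
  exact wlen_le _ (by simp [h1, h2])

theorem wlen_gen_le (i : I) : wlen r (r i) ≤ 1 := wlen_le [i] (by simp)

theorem exists_descent (hsq : ∀ i, r i * r i = 1) {w : G} (h : IsWord r w) (hw : w ≠ 1) :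
    ∃ i, wlen r (w * r i) < wlen r w := by
  obtain ⟨l, hl, h1⟩ := h.exists_word
  rcases List.eq_nil_or_concat l with h2 | ⟨l', i, h2⟩
  · subst h2; simp at h1; exact absurd h1.symm hw
  · subst h2
    refine ⟨i, ?_⟩
    rw [← hl]
    have : wlen r (w * r i) ≤ l'.length := by
      apply wlen_le
      rw [← h1]
      simp [mul_assoc, hsq]
    simp
    omega

theorem isWord_of_mem (hsq : ∀ i, r i * r i = 1) {w : G}
    (h : w ∈ Subgroup.closure (Set.range r)) : IsWord r w := by
  induction h using Subgroup.closure_induction with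
  | mem x hx => obtain ⟨i, rfl⟩ := hx; exact isWord_gen i
  | one => exact ⟨[], by simp⟩
  | mul x y _ _ hx hy => exact hx.mul hy
  | inv x _ hx =>
    obtain ⟨l, rfl⟩ := hx
    refine ⟨l.reverse, ?_⟩
    rw [List.prod_inv_reverse, List.map_reverse, List.map_map]
    congr 2
    apply List.map_congr_left
    intro i _
    exact eq_inv_of_mul_eq_one_left (hsq i)

/-- letters of alternating words -/
def cl (s t : I) (k : ℕ) : I := if Even k then t else s

variable (r) in
/-- alternating word ending in `t` -/
def lw (s t : I) : ℕ → G
  | 0 => 1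
  | k + 1 => r (cl s t k) * lw s t k

theorem cl_swap (s t : I) (k : ℕ) : cl s t (k + 1) = cl t s k := by
  unfold cl
  by_cases h : Even k <;> simp [h, Nat.even_add_one]

theorem lw_succ' (s t : I) (k : ℕ) : lw r s t (k + 1) = lw r t s k * r t := by
  induction k with
  | zero => simp [lw, cl]
  | succ k ih => rw [lw, ih, lw, cl_swap, mul_assoc]

theorem isWord_lw (s t : I) (k : ℕ) : IsWord r (lw r s t k) := by
  induction k with
  | zero => exact ⟨[], by simp [lw]⟩
  | succ k ih => exact (isWord_gen _).mul ih

theorem wlen_lw_le (s t : I) (k : ℕ) : wlen r (lw r s t k) ≤ k := by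
  induction k with
  | zero => exact wlen_le [] (by simp [lw])
  | succ k ih =>
    have := wlen_mul_le (isWord_gen (r := r) (cl s t k)) (isWord_lw (r := r) s t k)
    have := wlen_gen_le (r := r) (cl s t k)
    rw [lw]; omega

end words

section U
/-- Chebyshev-like sequence -/
def U (c : ℝ) : ℕ → ℝ
  | 0 => 0
  | 1 => 1
  | n + 2 => c * U c (n + 1) - U c n

theorem U_sin (θ : ℝ) (n : ℕ) : U (2 * Real.cos θ) n * Real.sin θ = Real.sin (n * θ) := by
  induction n using Nat.strong_induction_on with
  | _ n ih =>
    match n with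
    | 0 => simp [U]
    | 1 => simp [U]
    | n + 2 =>
      have h1 := ih (n + 1) (by omega)
      have h2 := ih n (by omega)
      rw [U, sub_mul, mul_assoc, h1, h2]
      push_cast
      have e1 : ((n : ℝ) + 2) * θ = (n + 1) * θ + θ := by ring
      have e2 : (n : ℝ) * θ = (n + 1) * θ - θ := by ring
      rw [e1, e2, Real.sin_add, Real.sin_sub]
      ring

theorem U_ge {c : ℝ} (hc : 2 ≤ c) (n : ℕ) : 0 ≤ U c n ∧ U c n ≤ U c (n + 1) := by
  induction n with
  | zero => simp [U]
  | succ n ih =>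
    refine ⟨ih.1.trans ih.2, ?_⟩
    rw [U]
    nlinarith [ih.1, ih.2]

end U
end CoxAux
namespace CoxAux
open scoped NNReal

section generic
variable {G : Type*} [Group G] {I : Type*} {r : I → G}
variable {V : Type*} [AddCommGroup V] [Module ℝ V]

theorem lw_apply (ρ : G →* Module.End ℝ V) (s t : I) (c : ℝ) (e₁ e₂ : V)
    (h11 : ρ (r s) e₁ = -e₁) (h12 : ρ (r s) e₂ = e₂ + c • e₁)
    (h22 : ρ (r t) e₂ = -e₂) (h21 : ρ (r t) e₁ = e₁ + c • e₂) (k : ℕ) :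
    ρ (lw r s t k) e₁ = U c (k + 1) • (if Even k then e₁ else e₂) +
      U c k • (if Even k then e₂ else e₁) := by
  induction k with
  | zero => simp [lw, U]
  | succ k ih =>
    rw [lw, map_mul, Module.End.mul_apply, ih, map_add, map_smul, map_smul]
    by_cases h : Even k
    · simp only [cl, h, if_true, Nat.even_add_one, not_true, if_false, h21, h22]
      rw [show U c (k + 1 + 1) = c * U c (k + 1) - U c k from rfl]
      module
    · simp only [cl, h, if_true, Nat.even_add_one, not_false_iff, if_false, h11, h12]
      rw [show U c (k + 1 + 1) = c * U c (k + 1) - U c k from rfl]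
      module

variable (ρ : G →* Module.End ℝ V) (hρ : Function.Injective ρ) (x : I → V)
    (f : I → V →ₗ[ℝ] ℝ) (hr : ∀ i v, ρ (r i) v = v - (2 * f i v) • x i)

include hr in
theorem lw_fix (s t : I) (v : V) (hs : f s v = 0) (ht : f t v = 0) (k : ℕ) :
    ρ (lw r s t k) v = v := by
  induction k with
  | zero => simp [lw]
  | succ k ih =>
    rw [lw, map_mul, Module.End.mul_apply, ih, hr]
    unfold cl
    split_ifs <;> simp [hs, ht]

theorem braid_vec (s t : I) (c : ℝ) (e₁ e₂ : V)
    (h11 : ρ (r s) e₁ = -e₁) (h12 : ρ (r s) e₂ = e₂ + c • e₁)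
    (h22 : ρ (r t) e₂ = -e₂) (h21 : ρ (r t) e₁ = e₁ + c • e₂) (m : ℕ)
    (hm : U c (m + 1) = 0) (hm' : U c m = 1) :
    ρ (lw r s t (m + 1)) e₁ = ρ (lw r t s (m + 1)) e₁ := by
  rw [lw_succ' t s, map_mul, Module.End.mul_apply, h11, map_neg,
    lw_apply ρ s t c e₁ e₂ h11 h12 h22 h21, lw_apply ρ s t c e₁ e₂ h11 h12 h22 h21, hm, hm',
    show U c (m + 1 + 1) = c * U c (m + 1) - U c m from rfl, hm, hm']
  by_cases h : Even m <;> simp [h, Nat.even_add_one]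

include hρ hr in
theorem dihedral (h1 : ∀ i, f i (x i) = 1) (s t : I)
    (hst : f t (x s) ≤ 0) (hts : f s (x t) ≤ 0)
    (h0 : f t (x s) = 0 → f s (x t) = 0) (h0' : f s (x t) = 0 → f t (x s) = 0)
    (h5 : (∃ m : ℕ, 2 ≤ m ∧ f t (x s) * f s (x t) = Real.cos (Real.pi / m) ^ 2) ∨
      1 ≤ f t (x s) * f s (x t)) (k : ℕ) :
    (∃ j, 1 ≤ j ∧ j ≤ k ∧ lw r s t j = lw r t s j) ∨
    ∃ p q : ℝ, 0 ≤ p ∧ 0 ≤ q ∧ ρ (lw r s t k) (x s) = p • x s + q • x t := by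
  by_cases ha : f t (x s) = 0
  · have hb := h0 ha
    by_cases hk : 2 ≤ k
    · left
      refine ⟨2, by norm_num, hk, hρ ?_⟩
      ext v
      simp only [lw, cl]
      simp [hr, ha, hb]
      module
    · right
      refine ⟨1, 0, zero_le_one, le_rfl, ?_⟩
      interval_cases k
      · simp [lw]
      · simp [lw, cl, hr, ha]
  have hb : f s (x t) ≠ 0 := fun h => ha (h0' h)
  set a : ℝ := -f t (x s) with hadef
  set b : ℝ := -f s (x t) with hbdef
  have hfa : f t (x s) = -a := by simp [hadef]
  have hfb : f s (x t) = -b := by simp [hbdef]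
  have ha' : 0 < a := by
    rcases lt_or_eq_of_le hst with h | h
    · linarith
    · exact absurd h ha
  have hb' : 0 < b := by
    rcases lt_or_eq_of_le hts with h | h
    · linarith
    · exact absurd h hb
  have hab : f t (x s) * f s (x t) = a * b := by rw [hfa, hfb]; ring
  rw [hab] at h5
  set γ := Real.sqrt (a * b) with hγ
  have hγ0 : 0 < γ := Real.sqrt_pos.2 (mul_pos ha' hb')
  have hγ2 : γ * γ = a * b := Real.mul_self_sqrt (mul_pos ha' hb').le
  set c := 2 * γ with hc
  have e11 : ρ (r s) (x s) = -x s := by rw [hr, h1]; module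
  have e22 : ρ (r t) ((a / γ) • x t) = -((a / γ) • x t) := by
    rw [map_smul, hr, h1]; module
  have e21 : ρ (r t) (x s) = x s + c • ((a / γ) • x t) := by
    rw [hr, hfa, smul_smul]
    have : c * (a / γ) = 2 * a := by rw [hc]; field_simp
    rw [this]; module
  have e12 : ρ (r s) ((a / γ) • x t) = (a / γ) • x t + c • x s := by
    rw [map_smul, hr, hfb, smul_sub, smul_smul]
    have : (a / γ) * (2 * -b) = -c := by
      rw [hc]; field_simp; nlinarith
    rw [this]; module
  have main : 0 ≤ U c (k + 1) → 0 ≤ U c k →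
      ∃ p q : ℝ, 0 ≤ p ∧ 0 ≤ q ∧ ρ (lw r s t k) (x s) = p • x s + q • x t := by
    intro hu1 hu2
    have hag : 0 ≤ a / γ := (div_pos ha' hγ0).le
    rw [lw_apply ρ s t c _ _ e11 e12 e22 e21]
    by_cases h : Even k
    · exact ⟨U c (k + 1), U c k * (a / γ), hu1, mul_nonneg hu2 hag, by simp [h, smul_smul]⟩
    · exact ⟨U c k, U c (k + 1) * (a / γ), hu2, mul_nonneg hu1 hag, by
        simp [h, smul_smul, add_comm]⟩
  rcases h5 with ⟨m, hm2, hm⟩ | h5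
  · have hm0 : (0 : ℝ) < m := by positivity
    have hmR : (2 : ℝ) ≤ m := by exact_mod_cast hm2
    have hθ0 : 0 < Real.pi / m := div_pos Real.pi_pos hm0
    have hθ1 : Real.pi / m ≤ Real.pi / 2 :=
      div_le_div_of_nonneg_left Real.pi_pos.le (by norm_num) hmR
    have hcos : 0 ≤ Real.cos (Real.pi / m) :=
      Real.cos_nonneg_of_mem_Icc ⟨by linarith, hθ1⟩
    have hγc : γ = Real.cos (Real.pi / m) := by
      rw [hγ, hm, Real.sqrt_sq hcos]
    have hsin : 0 < Real.sin (Real.pi / m) :=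
      Real.sin_pos_of_pos_of_lt_pi hθ0 (by linarith [Real.pi_pos])
    have hU : ∀ n, U c n * Real.sin (Real.pi / m) = Real.sin (n * (Real.pi / m)) := by
      intro n; rw [hc, hγc]; exact U_sin _ _
    have hUn : ∀ n, n ≤ m → 0 ≤ U c n := by
      intro n hn
      have hnR : (n : ℝ) ≤ m := by exact_mod_cast hn
      have : 0 ≤ Real.sin (n * (Real.pi / m)) := by
        apply Real.sin_nonneg_of_nonneg_of_le_pi (by positivity)
        calc (n : ℝ) * (Real.pi / m) ≤ m * (Real.pi / m) := by gcongr
          _ = Real.pi := by field_simp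
      rw [← hU] at this
      exact nonneg_of_mul_nonneg_left this hsin
    by_cases hk : k < m
    · right
      exact main (hUn _ hk) (hUn _ hk.le)
    · left
      obtain ⟨M, rfl⟩ : ∃ M, m = M + 1 := ⟨m - 1, by omega⟩
      refine ⟨M + 1, by omega, by omega, ?_⟩
      have u1 : U c (M + 1) = 0 := by
        have := hU (M + 1)
        rw [show ((M + 1 : ℕ) : ℝ) * (Real.pi / (M + 1 : ℕ)) = Real.pi by field_simp,
          Real.sin_pi] at this
        exact (mul_eq_zero.1 this).resolve_right hsin.ne'
      have u2 : U c M = 1 := by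
        have := hU M
        rw [show (M : ℝ) * (Real.pi / (M + 1 : ℕ)) = Real.pi - Real.pi / (M + 1 : ℕ) by
          field_simp; push_cast; ring, Real.sin_pi_sub] at this
        exact mul_right_cancel₀ hsin.ne' (this.trans (one_mul _).symm)
      have b1 := braid_vec ρ s t c _ _ e11 e12 e22 e21 M u1 u2
      have b2 := braid_vec ρ t s c _ _ e22 e21 e11 e12 M u1 u2
      have b3 : ρ (lw r s t (M + 1)) (x t) = ρ (lw r t s (M + 1)) (x t) := by
        rw [map_smul, map_smul] at b2
        exact (smul_right_injective V (div_pos ha' hγ0).ne' b2).symm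
      have hdet : 1 - a * b ≠ 0 := by
        rw [hm]
        have := Real.sin_sq_add_cos_sq (Real.pi / (M + 1 : ℕ))
        have h2 : 0 < Real.sin (Real.pi / (M + 1 : ℕ)) ^ 2 := by positivity
        intro h3; linarith
      apply hρ
      ext v
      set P := (f s v + b * f t v) / (1 - a * b) with hP
      set Q := (f t v + a * f s v) / (1 - a * b) with hQ
      set v0 := v - P • x s - Q • x t with hv0
      have hv : v = v0 + P • x s + Q • x t := by rw [hv0]; module
      have fs : f s v0 = 0 := by
        rw [hv0, map_sub, map_sub, map_smul, map_smul, h1, hfb, hP, hQ]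
        simp only [smul_eq_mul]
        apply mul_right_cancel₀ hdet
        linear_combination (-1) * div_mul_cancel₀ (f s v + b * f t v) hdet +
          b * div_mul_cancel₀ (f t v + a * f s v) hdet
      have ft : f t v0 = 0 := by
        rw [hv0, map_sub, map_sub, map_smul, map_smul, h1, hfa, hP, hQ]
        simp only [smul_eq_mul]
        apply mul_right_cancel₀ hdet
        linear_combination (-1) * div_mul_cancel₀ (f t v + a * f s v) hdet +
          a * div_mul_cancel₀ (f s v + b * f t v) hdet
      rw [hv]
      simp only [map_add, map_smul]
      rw [lw_fix ρ x f hr s t v0 fs ft, lw_fix ρ x f hr t s v0 ft fs, b1, b3]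
  · right
    have hc2 : 2 ≤ c := by
      have : 1 ≤ γ := by rw [hγ]; exact Real.one_le_sqrt.2 h5
      rw [hc]; linarith
    exact main (U_ge hc2 _).1 (U_ge hc2 _).1

include hρ hr in
theorem pos_of_le (hsq : ∀ i, r i * r i = 1) (h1 : ∀ i, f i (x i) = 1)
    (hneg : ∀ i j, i ≠ j → f j (x i) ≤ 0)
    (h0 : ∀ i j, f j (x i) = 0 → f i (x j) = 0)
    (h5 : ∀ i j, i ≠ j →
      (∃ m : ℕ, 2 ≤ m ∧ f j (x i) * f i (x j) = Real.cos (Real.pi / m) ^ 2) ∨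
      1 ≤ f j (x i) * f i (x j)) :
    ∀ n : ℕ, ∀ w : G, IsWord r w → wlen r w = n → ∀ i, wlen r w ≤ wlen r (w * r i) →
      ρ w (x i) ∈ cone (Set.range x) := by
  intro n
  induction n using Nat.strong_induction_on with
  | _ n ih =>
  intro w hw hn s hs
  by_cases hw1 : w = 1
  · subst hw1; simp; exact Submodule.subset_span ⟨s, rfl⟩
  obtain ⟨t, ht⟩ := exists_descent hsq hw hw1
  have hst : s ≠ t := by rintro rfl; omega
  have hinv : ∀ i, (r i)⁻¹ = r i := fun i => (eq_inv_of_mul_eq_one_left (hsq i)).symm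
  have hstep : ∀ k, w * (lw r s t (k + 1))⁻¹ = w * (lw r s t k)⁻¹ * r (cl s t k) := by
    intro k; rw [lw, mul_inv_rev, hinv, mul_assoc]
  have hword : ∀ k, IsWord r (w * (lw r s t k)⁻¹) := by
    intro k
    induction k with
    | zero => simpa [lw] using hw
    | succ k ihk => rw [hstep]; exact ihk.mul (isWord_gen _)
  have hlow : ∀ u : G, IsWord r u → ∀ i, wlen r u ≤ wlen r (u * r i) + 1 := by
    intro u hu i
    have h2 := wlen_mul_le (hu.mul (isWord_gen i)) (isWord_gen (r := r) i)
    rw [mul_assoc, hsq, mul_one] at h2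
    have := wlen_gen_le (r := r) i
    omega
  have hex : ∃ k, ¬ (wlen r (w * (lw r s t k)⁻¹) + k = wlen r w) :=
    ⟨wlen r w + 1, by omega⟩
  classical
  obtain ⟨K, hK, hKmin⟩ : ∃ K, ¬ (wlen r (w * (lw r s t K)⁻¹) + K = wlen r w) ∧
      ∀ j < K, wlen r (w * (lw r s t j)⁻¹) + j = wlen r w :=
    ⟨Nat.find hex, Nat.find_spec hex, fun j hj => not_not.1 (Nat.find_min hex hj)⟩
  have hK0 : K ≠ 0 := by rintro rfl; simp [lw] at hK
  have hK1 : K ≠ 1 := by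
    rintro rfl
    apply hK
    rw [hstep 0]
    have h3 := hlow w hw t
    simp only [lw, cl, inv_one, mul_one, Even.zero, if_true]
    omega
  obtain ⟨k, rfl⟩ : ∃ k, K = k + 2 := ⟨K - 2, by omega⟩
  have hk := hKmin (k + 1) (by omega)
  have hk' := hKmin k (by omega)
  set v := w * (lw r s t (k + 1))⁻¹ with hv
  have hwv : w = v * lw r s t (k + 1) := by rw [hv]; group
  have hvn : wlen r v < n := by omega
  have hvc1 : wlen r v ≤ wlen r (v * r (cl s t (k + 1))) := by
    have h3 := hlow v (hword _) (cl s t (k + 1))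
    have h4 : ¬ (wlen r (v * r (cl s t (k + 1))) + (k + 2) = wlen r w) := by
      rw [← hstep (k + 1)]; exact hK
    omega
  have hvc2 : wlen r v ≤ wlen r (v * r (cl s t k)) := by
    have : v * r (cl s t k) = w * (lw r s t k)⁻¹ := by
      rw [hv, hstep, mul_assoc, hsq, mul_one]
    rw [this]; omega
  have p1 := ih _ hvn v (hword _) rfl _ hvc1
  have p2 := ih _ hvn v (hword _) rfl _ hvc2
  have pst : ρ v (x s) ∈ cone (Set.range x) ∧ ρ v (x t) ∈ cone (Set.range x) := by
    unfold cl at p1 p2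
    by_cases h : Even k
    · simp [h, Nat.even_add_one] at p1 p2; exact ⟨p1, p2⟩
    · simp [h, Nat.even_add_one] at p1 p2; exact ⟨p2, p1⟩
  rcases dihedral ρ hρ x f hr h1 s t (hneg s t hst) (hneg t s hst.symm) (h0 s t) (h0 t s)
    (h5 s t hst) (k + 1) with ⟨j, hj1, hjk, hj⟩ | ⟨p, q, hp, hq, hpq⟩
  · exfalso
    have hkj := hKmin j (by omega)
    obtain ⟨i, rfl⟩ : ∃ i, j = i + 1 := ⟨j - 1, by omega⟩
    have e : w * r s = (w * (lw r s t (i + 1))⁻¹) * lw r s t i := by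
      have : lw r s t i = lw r s t (i + 1) * r s := by
        rw [hj, lw_succ', mul_assoc, hsq, mul_one]
      rw [this]; group
    have h3 := wlen_mul_le (hword (i + 1)) (isWord_lw (r := r) s t i)
    rw [← e] at h3
    have h4 := wlen_lw_le (r := r) s t i
    omega
  · rw [hwv, map_mul, Module.End.mul_apply, hpq, map_add, map_smul, map_smul]
    exact Submodule.add_mem _ (smul_mem_cone pst.1 hp) (smul_mem_cone pst.2 hq)

include hρ hr in
theorem neg_of_lt (hsq : ∀ i, r i * r i = 1) (h1 : ∀ i, f i (x i) = 1)
    (hneg : ∀ i j, i ≠ j → f j (x i) ≤ 0)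
    (h0 : ∀ i j, f j (x i) = 0 → f i (x j) = 0)
    (h5 : ∀ i j, i ≠ j →
      (∃ m : ℕ, 2 ≤ m ∧ f j (x i) * f i (x j) = Real.cos (Real.pi / m) ^ 2) ∨
      1 ≤ f j (x i) * f i (x j))
    (w : G) (hw : IsWord r w) (hw1 : w ≠ 1) : ∃ i, -ρ w (x i) ∈ cone (Set.range x) := by
  obtain ⟨i, hi⟩ := exists_descent hsq hw hw1
  refine ⟨i, ?_⟩
  have := pos_of_le ρ hρ x f hr hsq h1 hneg h0 h5 _ (w * r i) (hw.mul (isWord_gen i)) rfl i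
    (by rw [mul_assoc, hsq, mul_one]; exact hi.le)
  rw [map_mul, Module.End.mul_apply, hr, h1] at this
  have e : x i - (2 * 1 : ℝ) • x i = -x i := by module
  rwa [e, map_neg] at this

end generic
end CoxAux
namespace CoxAux
open scoped NNReal

section datum
variable {S V₁ V₂ W : Type*} [AddCommGroup V₁] [Module ℝ V₁]
  [AddCommGroup V₂] [Module ℝ V₂] [Group W] (D : CoxeterDatum S V₁ V₂ W)

theorem isWord_all (w : W) : IsWord D.r w :=
  isWord_of_mem D.r_sq (by rw [D.r_gen]; trivial)

theorem rho_mul (u w : W) (v : V₁) : D.ρ₁ (u * w) v = D.ρ₁ u (D.ρ₁ w v) := by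
  rw [map_mul, Module.End.mul_apply]

theorem root_mul {z : V₁} (hz : z ∈ D.Phi₁) (w : W) : D.ρ₁ w z ∈ D.Phi₁ := by
  obtain ⟨u, s, rfl⟩ := hz
  exact ⟨w * u, s, by rw [rho_mul]⟩

theorem refl_conj {z : V₁} (hz : z ∈ D.Phi₁) (w : W) :
    D.refl₁ (D.ρ₁ w z) = w * D.refl₁ z * w⁻¹ := by
  obtain ⟨u, s, rfl⟩ := hz
  rw [← rho_mul, D.refl₁_eq, D.refl₁_eq]
  group

theorem refl_sq {z : V₁} (hz : z ∈ D.Phi₁) : D.refl₁ z * D.refl₁ z = 1 := by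
  obtain ⟨u, s, rfl⟩ := hz
  rw [D.refl₁_eq]
  calc u * D.r s * u⁻¹ * (u * D.r s * u⁻¹) = u * (D.r s * D.r s) * u⁻¹ := by group
    _ = 1 := by rw [D.r_sq]; group

theorem refl_mem_T {z : V₁} (hz : z ∈ D.Phi₁) : D.refl₁ z ∈ D.T := by
  obtain ⟨u, s, rfl⟩ := hz
  exact ⟨u, s, D.refl₁_eq u s⟩

theorem pair_self {z : V₁} (hz : z ∈ D.Phi₁) : D.pair z (D.phi z) = 1 := by
  obtain ⟨u, s, rfl⟩ := hz
  rw [D.phi_equiv u _ ⟨1, s, by simp⟩, D.pair_inv, D.phi_simple, D.D1]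

theorem root_ne_zero {z : V₁} (hz : z ∈ D.Phi₁) : z ≠ 0 := by
  intro h
  have := pair_self D hz
  rw [h] at this
  simp at this

theorem refl_self {z : V₁} (hz : z ∈ D.Phi₁) : D.ρ₁ (D.refl₁ z) z = -z := by
  rw [D.refl₁_act z hz, pair_self D hz]; module

theorem refl_ne_one {z : V₁} (hz : z ∈ D.Phi₁) : D.refl₁ z ≠ 1 := by
  intro h
  have := refl_self D hz
  rw [h] at this
  simp only [map_one, Module.End.one_apply] at this
  have h2 := congrArg (fun v => D.pair v (D.phi z)) this
  simp only [map_neg, LinearMap.neg_apply, pair_self D hz] at h2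
  norm_num at h2

theorem root_neg {z : V₁} (hz : z ∈ D.Phi₁) : -z ∈ D.Phi₁ := by
  rw [← refl_self D hz]; exact root_mul D hz _

theorem refl_neg {z : V₁} (hz : z ∈ D.Phi₁) : D.refl₁ (-z) = D.refl₁ z := by
  rw [← refl_self D hz, refl_conj D hz, mul_assoc, mul_inv_cancel, mul_one]

theorem alpha_root (s : S) : D.α s ∈ D.Phi₁ := ⟨1, s, by simp⟩

theorem refl_alpha (s : S) : D.refl₁ (D.α s) = D.r s := by
  have := D.refl₁_eq 1 s
  simpa using this

/-- the cone of simple roots -/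
abbrev C : Submodule ℝ≥0 V₁ := cone (Set.range D.α)

theorem C_pointed (u : V₁) (hu : u ∈ C D) (hv : -u ∈ C D) : u = 0 := pointed D.D2a hu hv

theorem pos_iff {z : V₁} (hz : z ∈ D.Phi₁) : z ∈ D.PhiPos₁ ↔ z ∈ C D :=
  ⟨fun h => mem_cone_of h.2, fun h => ⟨hz, mem_PLC_of h (root_ne_zero D hz)⟩⟩

theorem pos_or_neg {z : V₁} (hz : z ∈ D.Phi₁) : z ∈ C D ∨ -z ∈ C D := by
  have : z ∈ ({ v | ∃ w s, v = D.ρ₁ w (D.α s) } : Set V₁) := hz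
  rw [D.decomp₁] at this
  rcases this with h | h
  · exact Or.inl (mem_cone_of h.2)
  · exact Or.inr (mem_cone_of h.2)

theorem not_both {z : V₁} (hz : z ∈ D.Phi₁) (h : z ∈ C D) : ¬ (-z ∈ C D) :=
  fun h' => root_ne_zero D hz (C_pointed D z h h')

/-- pairing with a fixed second vector -/
abbrev fl (y : V₂) : V₁ →ₗ[ℝ] ℝ := D.pair.flip y

theorem D_descent (w : W) (hw : w ≠ 1) : ∃ s, -D.ρ₁ w (D.α s) ∈ C D :=
  neg_of_lt (r := D.r) D.ρ₁ D.ρ₁_inj D.α (fun s => fl D (D.β s))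
    (fun i v => by simp [D.hr₁]) D.r_sq (fun i => by simp [D.D1])
    (fun i j h => by simpa using D.D3 i j h)
    (fun i j h => by simpa using D.D4 i j (by simpa using h))
    (fun i j h => by simpa using D.D5 i j h) w (isWord_all D w) hw

theorem simple_prop (s : S) {z : V₁} (hz : z ∈ C D) {k : ℝ}
    (hk : -(z - k • D.α s) ∈ C D) : ∃ p : ℝ, z = p • D.α s := by
  refine prop_of (C_pointed D) (fl D (D.β s)) ⟨s, rfl⟩ (by simp [D.D1]) ?_ hz hk
  rintro _ ⟨t, rfl⟩ h
  simpa using D.D3 t s (fun e => h (by rw [e]))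

theorem refl_of_prop_simple {v : V₁} (hv : v ∈ D.Phi₁) (s : S) (p : ℝ) (hp : v = p • D.α s) :
    D.refl₁ v = D.r s := by
  have hp0 : p ≠ 0 := by
    rintro rfl
    exact root_ne_zero D hv (by simpa using hp)
  have hfix : D.ρ₁ (D.refl₁ v) (D.α s) = -D.α s := by
    have := refl_self D hv
    nth_rewrite 2 3 [hp] at this
    rw [map_smul, ← smul_neg] at this
    exact smul_right_injective V₁ hp0 this
  have hone : D.refl₁ v * D.r s = 1 := by
    by_contra hne
    obtain ⟨t, ht⟩ := D_descent D _ hne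
    rw [rho_mul, D.hr₁] at ht
    by_cases hts : t = s
    · subst hts
      rw [D.D1, map_sub, map_smul, hfix] at ht
      have e : -(-D.α t - (2 * 1 : ℝ) • -D.α t) = -D.α t := by module
      rw [e] at ht
      exact not_both D (alpha_root D t) (Submodule.subset_span ⟨t, rfl⟩) ht
    · rw [map_sub, map_smul, hfix, D.refl₁_act v hv, hp, smul_smul] at ht
      have e : ∀ a b : ℝ, -(D.α t - a • D.α s - b • -D.α s) = -(D.α t - (a - b) • D.α s) := by
        intro a b; module
      rw [e] at ht
      obtain ⟨q, hq⟩ := simple_prop D s (Submodule.subset_span (Set.mem_range_self t)) ht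
      have h1 := D.D3 t s hts
      rw [hq, map_smul, LinearMap.smul_apply, D.D1, smul_eq_mul, mul_one] at h1
      refine not_both D (alpha_root D t) (Submodule.subset_span ⟨t, rfl⟩) ?_
      rw [hq, ← neg_smul]
      exact smul_mem_cone (Submodule.subset_span (Set.mem_range_self s)) (by linarith)
  calc D.refl₁ v = D.refl₁ v * D.r s * D.r s := by rw [mul_assoc, D.r_sq, mul_one]
    _ = D.r s := by rw [hone, one_mul]

theorem refl_of_prop {v z : V₁} (hv : v ∈ D.Phi₁) (hz : z ∈ D.Phi₁) (p : ℝ) (hp : v = p • z) :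
    D.refl₁ v = D.refl₁ z := by
  obtain ⟨u, s, rfl⟩ := hz
  have h := refl_of_prop_simple D (root_mul D hv u⁻¹) s p (by
    rw [hp, map_smul, ← rho_mul]; simp)
  rw [refl_conj D hv] at h
  rw [D.refl₁_eq, ← h]
  group

theorem prop_of_refl {v z : V₁} (hv : v ∈ D.Phi₁) (hz : z ∈ D.Phi₁)
    (h : D.refl₁ v = D.refl₁ z) : v = D.pair v (D.phi z) • z := by
  have h1 := refl_self D hv
  rw [h, D.refl₁_act z hz, mul_smul] at h1
  have h2 : (2 : ℝ) • v = (2 : ℝ) • (D.pair v (D.phi z) • z) := by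
    rw [two_smul ℝ v]
    nth_rewrite 1 [← neg_neg v]
    rw [← h1]; module
  exact smul_right_injective V₁ (two_ne_zero) h2

theorem exchange (l : List S) {z : V₁} (hz : z ∈ D.Phi₁) (hzC : z ∈ C D)
    (h : -D.ρ₁ (l.map D.r).prod z ∈ C D) :
    ∃ l' : List S, l'.length + 1 = l.length ∧
      (l'.map D.r).prod = (l.map D.r).prod * D.refl₁ z := by
  induction l with
  | nil => simp at h; exact absurd h (not_both D hz hzC)
  | cons s l ih =>
    rcases pos_or_neg D (root_mul D hz (l.map D.r).prod) with h1 | h1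
    · refine ⟨l, rfl, ?_⟩
      rw [List.map_cons, List.prod_cons, rho_mul, D.hr₁] at h
      obtain ⟨p, hp⟩ := simple_prop D s h1 h
      have := refl_of_prop_simple D (root_mul D hz _) s p hp
      rw [refl_conj D hz] at this
      rw [List.map_cons, List.prod_cons, ← this]
      set g := (l.map D.r).prod
      calc g = g * (D.refl₁ z * D.refl₁ z) := by rw [refl_sq D hz, mul_one]
        _ = _ := by group
    · obtain ⟨l', h2, h3⟩ := ih h1
      exact ⟨s :: l', by simp [h2], by simp [h3, mul_assoc]⟩

theorem len_lt_of_neg (w : W) {z : V₁} (hz : z ∈ D.Phi₁) (hzC : z ∈ C D)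
    (h : -D.ρ₁ w z ∈ C D) : D.len (w * D.refl₁ z) < D.len w := by
  obtain ⟨l, hl, rfl⟩ := (isWord_all D w).exists_word
  obtain ⟨l', h1, h2⟩ := exchange D l hz hzC h
  have : D.len ((l.map D.r).prod * D.refl₁ z) ≤ l'.length := wlen_le l' h2
  change _ < wlen D.r _
  omega

theorem neg_of_len_lt (w : W) {z : V₁} (hz : z ∈ D.Phi₁) (hzC : z ∈ C D)
    (h : D.len (w * D.refl₁ z) < D.len w) : -D.ρ₁ w z ∈ C D := by
  rcases pos_or_neg D (root_mul D hz w) with h1 | h1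
  · exfalso
    have := len_lt_of_neg D (w * D.refl₁ z) hz hzC (by
      rw [rho_mul, refl_self D hz, map_neg, neg_neg]; exact h1)
    rw [mul_assoc, refl_sq D hz, mul_one] at this
    omega
  · exact h1

theorem exists_pos_root {t : W} (ht : t ∈ D.T) : ∃ z ∈ D.Phi₁, z ∈ C D ∧ D.refl₁ z = t := by
  obtain ⟨w, s, rfl⟩ := ht
  have hz : D.ρ₁ w (D.α s) ∈ D.Phi₁ := ⟨w, s, rfl⟩
  rcases pos_or_neg D hz with h | h
  · exact ⟨_, hz, h, D.refl₁_eq w s⟩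
  · exact ⟨_, root_neg D hz, h, by rw [refl_neg D hz, D.refl₁_eq]⟩

theorem refl₂_phi {z : V₁} (hz : z ∈ D.Phi₁) : D.refl₂ (D.phi z) = D.refl₁ z := by
  obtain ⟨u, s, rfl⟩ := hz
  rw [D.phi_equiv u _ (alpha_root D s), D.phi_simple, D.refl₂_eq, D.refl₁_eq]

theorem pair_self₂ {y : V₂} (hy : y ∈ D.Phi₂) : D.pair (D.phiInv y) y = 1 := by
  have := pair_self D (D.phiInv_mem y hy)
  rwa [D.phi_phiInv y hy] at this

theorem prop_of_refl₂ {v z : V₂} (hv : v ∈ D.Phi₂) (hz : z ∈ D.Phi₂)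
    (h : D.refl₂ v = D.refl₂ z) : v = D.pair (D.phiInv z) v • z := by
  have h1 : D.ρ₂ (D.refl₂ v) v = -v := by
    rw [D.refl₂_act v hv, pair_self₂ D hv]; module
  rw [h, D.refl₂_act z hz, mul_smul] at h1
  have h2 : (2 : ℝ) • v = (2 : ℝ) • (D.pair (D.phiInv z) v • z) := by
    rw [two_smul ℝ v]
    nth_rewrite 1 [← neg_neg v]
    rw [← h1]; module
  exact smul_right_injective V₂ (two_ne_zero) h2

theorem rayClass_eq {V : Type*} [AddCommGroup V] [Module ℝ V] {v z : V} {c : ℝ} (hv : v ≠ 0)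
    (h : v = c • z) : rayClass v = rayClass z := by
  have hc : c ≠ 0 := by rintro rfl; simp at h; exact hv h
  ext u
  constructor
  · rintro ⟨d, hd, rfl⟩
    exact ⟨d * c, mul_ne_zero hd hc, by rw [h, smul_smul]⟩
  · rintro ⟨d, hd, rfl⟩
    exact ⟨d / c, div_ne_zero hd hc, by rw [h, smul_smul, div_mul_cancel₀ _ hc]⟩

section main
variable (Δ : Set V₁) (h₁ : Δ ⊆ D.PhiPos₁)
    (A2 : ∀ x ∈ Δ, ∀ x' ∈ Δ, x ≠ x' → D.pair x (D.phi x') ≤ 0)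
    (A3 : ∀ x ∈ Δ, ∀ x' ∈ Δ, D.refl₁ x ≠ D.refl₁ x' →
      (∃ m : ℕ, 2 ≤ m ∧
          D.pair x (D.phi x') * D.pair x' (D.phi x) = Real.cos (Real.pi / m) ^ 2) ∨
        1 ≤ D.pair x (D.phi x') * D.pair x' (D.phi x))

include h₁ A2 in
theorem refl_ne {x x' : V₁} (hx : x ∈ Δ) (hx' : x' ∈ Δ) (hne : x ≠ x') :
    D.refl₁ x ≠ D.refl₁ x' := by
  intro h
  have h2 := prop_of_refl D (h₁ hx).1 (h₁ hx').1 h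
  refine not_both D (h₁ hx).1 (mem_cone_of (h₁ hx).2) ?_
  rw [h2, ← neg_smul]
  exact smul_mem_cone (mem_cone_of (h₁ hx').2) (by linarith [A2 x hx x' hx' hne])

theorem pair_symm_zero {x x' : V₁} (hx : x ∈ D.Phi₁) (hx' : x' ∈ D.Phi₁)
    (h : D.pair x (D.phi x') = 0) : D.pair x' (D.phi x) = 0 := by
  by_contra hne
  have e1 : D.ρ₁ (D.refl₁ x') x = x := by rw [D.refl₁_act x' hx', h]; simp
  have e2 := refl_conj D hx (D.refl₁ x')
  rw [e1] at e2
  have e3 : D.refl₁ (D.ρ₁ (D.refl₁ x) x') = D.refl₁ x' := by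
    rw [refl_conj D hx']
    have : D.refl₁ x * D.refl₁ x' = D.refl₁ x' * D.refl₁ x := by
      nth_rewrite 1 [e2]; group
    rw [this]; group
  have e4 := prop_of_refl D (root_mul D hx' _) hx' e3
  rw [D.refl₁_act x hx] at e4
  have e5 := congrArg (fun v => D.pair v (D.phi x)) e4
  simp only [map_sub, map_smul, LinearMap.sub_apply, LinearMap.smul_apply, smul_eq_mul,
    pair_self D hx, pair_self D hx', h] at e5
  have : D.pair x' (D.phi x) = 0 := by linarith
  exact hne this

include h₁ A2 A3 in
theorem Delta_descent (w : W) (hw : w ∈ Subgroup.closure (D.refl₁ '' Δ)) (hw1 : w ≠ 1) :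
    ∃ x ∈ Δ, -D.ρ₁ w x ∈ cone Δ := by
  have hsq : ∀ i : Δ, D.refl₁ i * D.refl₁ i = 1 := fun i => refl_sq D (h₁ i.2).1
  have hrange : Set.range (fun i : Δ => D.refl₁ i) = D.refl₁ '' Δ := by
    ext; simp
  obtain ⟨i, hi⟩ := neg_of_lt (r := fun i : Δ => D.refl₁ i) D.ρ₁ D.ρ₁_inj
    (fun i : Δ => (i : V₁)) (fun i => fl D (D.phi i))
    (fun i v => by simp [D.refl₁_act i (h₁ i.2).1]) hsq
    (fun i => by simp [pair_self D (h₁ i.2).1])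
    (fun i j h => by
      simpa using A2 i i.2 j j.2 (fun e => h (Subtype.ext e)))
    (fun i j h => by
      simpa using pair_symm_zero D (h₁ i.2).1 (h₁ j.2).1 (by simpa using h))
    (fun i j h => by
      simpa using A3 i i.2 j j.2 (refl_ne D Δ h₁ A2 i.2 j.2 (fun e => h (Subtype.ext e))))
    w (isWord_of_mem hsq (by rw [hrange]; exact hw)) hw1
  refine ⟨i, i.2, ?_⟩
  simpa using hi

include h₁ in
theorem cone_le : cone Δ ≤ C D :=
  Submodule.span_le.2 fun x hx => mem_cone_of (h₁ hx).2

include h₁ A2 A3 in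
theorem pos_mem_cone {z : V₁} (hz : z ∈ D.Phi₁) (hzC : z ∈ C D)
    (hW : D.refl₁ z ∈ Subgroup.closure (D.refl₁ '' Δ)) : z ∈ cone Δ := by
  obtain ⟨y, hy, hyn⟩ := Delta_descent D Δ h₁ A2 A3 _ hW (refl_ne_one D hz)
  rw [D.refl₁_act z hz] at hyn
  have hyC : y ∈ cone Δ := Submodule.subset_span hy
  set k := 2 * D.pair y (D.phi z) with hk
  have h2 : k • z ∈ cone Δ := by
    have : k • z = y + -(y - k • z) := by module
    rw [this]; exact Submodule.add_mem _ hyC hyn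
  have hyroot := (h₁ hy).1
  have hk0 : 0 < k := by
    by_contra hle
    have hn : -y ∈ C D := by
      have : -y = -(y - k • z) + (-k) • z := by module
      rw [this]
      exact Submodule.add_mem _ (cone_le D Δ h₁ hyn) (smul_mem_cone hzC (by linarith))
    exact not_both D hyroot (cone_le D Δ h₁ hyC) hn
  have h3 := smul_mem_cone h2 (inv_nonneg.2 hk0.le)
  rwa [smul_smul, inv_mul_cancel₀ hk0.ne', one_smul] at h3

include h₁ A2 A3 in
theorem SW_eq : D.SW (Subgroup.closure (D.refl₁ '' Δ)) = D.refl₁ '' Δ := by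
  set W' := Subgroup.closure (D.refl₁ '' Δ) with hW'
  have hgen : ∀ x ∈ Δ, D.refl₁ x ∈ W' := fun x hx => Subgroup.subset_closure ⟨x, hx, rfl⟩
  apply Set.Subset.antisymm
  · rintro t ⟨htT, ht⟩
    have htW : t ∈ W' := by
      have : t ∈ D.Nbar t ∩ (W' : Set W) := by rw [ht]; rfl
      exact this.2
    obtain ⟨z, hz, hzC, rfl⟩ := exists_pos_root D htT
    obtain ⟨y, hy, hyn⟩ := Delta_descent D Δ h₁ A2 A3 _ htW (refl_ne_one D hz)
    have : D.refl₁ y ∈ D.Nbar (D.refl₁ z) ∩ (W' : Set W) :=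
      ⟨⟨refl_mem_T D (h₁ hy).1, len_lt_of_neg D _ (h₁ hy).1 (mem_cone_of (h₁ hy).2)
        (cone_le D Δ h₁ hyn)⟩, hgen y hy⟩
    rw [ht] at this
    exact ⟨y, hy, this⟩
  · rintro _ ⟨x, hx, rfl⟩
    have hxr := (h₁ hx).1
    have hxC : x ∈ C D := mem_cone_of (h₁ hx).2
    refine ⟨refl_mem_T D hxr, ?_⟩
    apply Set.Subset.antisymm
    · rintro t ⟨⟨htT, hlt⟩, htW⟩
      obtain ⟨z, hz, hzC, rfl⟩ := exists_pos_root D htT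
      have hneg := neg_of_len_lt D _ hz hzC hlt
      have hz1 := pos_mem_cone D Δ h₁ A2 A3 hz hzC htW
      have hroot := root_neg D (root_mul D hz (D.refl₁ x))
      have hz2 := pos_mem_cone D Δ h₁ A2 A3 hroot hneg (by
        rw [refl_neg D (root_mul D hz _), refl_conj D hz]
        exact mul_mem (mul_mem (hgen x hx) htW) (inv_mem (hgen x hx)))
      rw [D.refl₁_act x hxr] at hz2
      obtain ⟨p, hp⟩ := prop_of
        (fun u hu hu' => C_pointed D u (cone_le D Δ h₁ hu) (cone_le D Δ h₁ hu'))
        (fl D (D.phi x)) hx (by simp [pair_self D hxr])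
        (fun a ha hne => by simpa using A2 a ha x hx hne) hz1 hz2
      exact refl_of_prop D hz hxr p hp
    · rintro _ rfl
      refine ⟨⟨refl_mem_T D hxr, len_lt_of_neg D _ hxr hxC ?_⟩, hgen x hx⟩
      rw [refl_self D hxr, neg_neg]; exact hxC

end main
end datum
end CoxAux

/-- If `Δ'₁ ⊆ Φ₁⁺` and `Δ'₂ ⊆ Φ₂⁺` satisfy (A1) `φ(Δ'₁) = Δ'₂`,
(A2) `⟨x, φ x'⟩ ≤ 0` for all distinct `x, x' ∈ Δ'₁`, and (A3)
`⟨x, φ x'⟩⟨x', φ x⟩ ∈ {cos²(π/m) : m ≥ 2} ∪ [1, ∞)` for all `x, x' ∈ Δ'₁` with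
`r_x ≠ r_{x'}`, then `W' = ⟨{r_x : x ∈ Δ'₁}⟩` is a reflection subgroup of `W` with
`Δ̂'₁ = Δ̂₁(W')` and `Δ̂'₂ = Δ̂₂(W')`. -/
theorem stmt12 {S V₁ V₂ W : Type*} [AddCommGroup V₁] [Module ℝ V₁]
    [AddCommGroup V₂] [Module ℝ V₂] [Group W]
    (D : CoxeterDatum S V₁ V₂ W)
    (Δ'₁ : Set V₁) (Δ'₂ : Set V₂)
    (h₁ : Δ'₁ ⊆ D.PhiPos₁) (h₂ : Δ'₂ ⊆ D.PhiPos₂)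
    (A1 : D.phi '' Δ'₁ = Δ'₂)
    (A2 : ∀ x ∈ Δ'₁, ∀ x' ∈ Δ'₁, x ≠ x' → D.pair x (D.phi x') ≤ 0)
    (A3 : ∀ x ∈ Δ'₁, ∀ x' ∈ Δ'₁, D.refl₁ x ≠ D.refl₁ x' →
      (∃ m : ℕ, 2 ≤ m ∧
          D.pair x (D.phi x') * D.pair x' (D.phi x) = Real.cos (Real.pi / m) ^ 2) ∨
        1 ≤ D.pair x (D.phi x') * D.pair x' (D.phi x)) :
    D.IsReflectionSubgroup (Subgroup.closure (D.refl₁ '' Δ'₁)) ∧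
    rayClasses Δ'₁ = rayClasses (D.Delta₁ (Subgroup.closure (D.refl₁ '' Δ'₁))) ∧
    rayClasses Δ'₂ = rayClasses (D.Delta₂ (Subgroup.closure (D.refl₁ '' Δ'₁))) := by
  have hSW := CoxAux.SW_eq D Δ'₁ h₁ A2 A3
  refine ⟨?_, ?_, ?_⟩
  · apply le_antisymm
    · rw [Subgroup.closure_le]
      rintro _ ⟨x, hx, rfl⟩
      exact Subgroup.subset_closure
        ⟨Subgroup.subset_closure ⟨x, hx, rfl⟩, CoxAux.refl_mem_T D (h₁ hx).1⟩
    · rw [Subgroup.closure_le]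
      exact Set.inter_subset_left
  · ext Cl
    constructor
    · rintro ⟨z, hz, rfl⟩
      exact ⟨z, ⟨h₁ hz, by rw [hSW]; exact ⟨z, hz, rfl⟩⟩, rfl⟩
    · rintro ⟨z, ⟨hz, hzS⟩, rfl⟩
      rw [hSW] at hzS
      obtain ⟨y, hy, hyz⟩ := hzS
      exact ⟨y, hy, CoxAux.rayClass_eq (CoxAux.root_ne_zero D hz.1)
        (CoxAux.prop_of_refl D hz.1 (h₁ hy).1 hyz.symm)⟩
  · ext Cl
    constructor
    · rintro ⟨z, hz, rfl⟩
      refine ⟨z, ⟨h₂ hz, ?_⟩, rfl⟩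
      rw [← A1] at hz
      obtain ⟨x, hx, rfl⟩ := hz
      rw [hSW, CoxAux.refl₂_phi D (h₁ hx).1]
      exact ⟨x, hx, rfl⟩
    · rintro ⟨z, ⟨hz, hzS⟩, rfl⟩
      rw [hSW] at hzS
      obtain ⟨y, hy, hyz⟩ := hzS
      rw [← CoxAux.refl₂_phi D (h₁ hy).1] at hyz
      have hne : z ≠ 0 := by
        intro h
        have := CoxAux.pair_self₂ D hz.1
        rw [h] at this
        simp at this
      have hyΔ : D.phi y ∈ Δ'₂ := by rw [← A1]; exact ⟨y, hy, rfl⟩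
      exact ⟨D.phi y, hyΔ, CoxAux.rayClass_eq hne
        (CoxAux.prop_of_refl₂ D hz.1 (h₂ hyΔ).1 hyz.symm)⟩
end
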